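/- arXiv:2507.13188 — 10 statements merged into one kernel-verified Lean document; each statement's English description precedes it below -/
import Mathlib

section
/- Finite-dimensional analogue of the continuity bound (2.15) for the space-time bilinear form: for every continuous v : [0,T] → ℝ^m, every v_T ∈ ℝ^m and every continuously differentiable φ : [0,T] → ℝ^m, one has |B((v,v_T),φ)| ≤ ‖(v,v_T)‖_Z · ‖φ‖_Y. -/
open scoped RealInnerProductSpace

section

variable {E : Type*} [NormedAddCommGroup E] [InnerProductSpace ℝ E]

/-- A symmetric form expands as a quadratic polynomial along a line. -/
theorem inner_map_smul_add_self (A : E →ₗ[ℝ] E) (hsym : ∀ x y, ⟪A x, y⟫ = ⟪x, A y⟫)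
    (s : ℝ) (x y : E) :
    ⟪A (s • x + y), s • x + y⟫ = s * s * ⟪A x, x⟫ + 2 * s * ⟪A y, x⟫ + ⟪A y, y⟫ := by
  have h : ⟪A x, y⟫ = ⟪A y, x⟫ := by rw [hsym, real_inner_comm]
  simp only [map_add, map_smul, inner_add_left, inner_add_right, real_inner_smul_left,
    real_inner_smul_right, h]
  ring

/-- The integral of the derivative of the squared norm is its increment. -/
theorem integral_inner_deriv_self {φ φ' : ℝ → E} {T : ℝ} (hT : 0 ≤ T)
    (hφ : ∀ t ∈ Set.Icc (0:ℝ) T, HasDerivWithinAt φ (φ' t) (Set.Icc (0:ℝ) T) t)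
    (hφ' : ContinuousOn φ' (Set.Icc (0:ℝ) T)) :
    ∫ t in (0:ℝ)..T, 2 * ⟪φ' t, φ t⟫ = ‖φ T‖ ^ 2 - ‖φ 0‖ ^ 2 := by
  have hc : ContinuousOn φ (Set.Icc (0:ℝ) T) := fun t ht => (hφ t ht).continuousWithinAt
  refine intervalIntegral.integral_eq_sub_of_hasDerivAt_of_le (f := fun t => ‖φ t‖ ^ 2) hT
    (hc.norm.pow 2) (fun t ht => ?_)
    (ContinuousOn.intervalIntegrable_of_Icc hT (continuousOn_const.mul (hφ'.inner hc)))
  have h := ((hφ t (Set.Ioo_subset_Icc_self ht)).hasDerivAt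
    (Icc_mem_nhds ht.1 ht.2)).norm_sq
  rwa [real_inner_comm] at h

/-- Cauchy–Schwarz for the form `∫ ⟪A x, y⟫ + ½ ⟪a, b⟫`. -/
theorem abs_integral_inner_map_add_le (A : E →L[ℝ] E) (hsym : ∀ x y, ⟪A x, y⟫ = ⟪x, A y⟫)
    (hnonneg : ∀ x, 0 ≤ ⟪A x, x⟫) {T : ℝ} (hT : 0 ≤ T) {v w : ℝ → E}
    (hv : ContinuousOn v (Set.Icc (0:ℝ) T)) (hw : ContinuousOn w (Set.Icc (0:ℝ) T)) (a b : E) :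
    |(1/2) * ⟪a, b⟫ + ∫ t in (0:ℝ)..T, ⟪A (w t), v t⟫|
      ≤ Real.sqrt ((∫ t in (0:ℝ)..T, ⟪A (v t), v t⟫) + (1/2) * ‖a‖ ^ 2)
        * Real.sqrt ((∫ t in (0:ℝ)..T, ⟪A (w t), w t⟫) + (1/2) * ‖b‖ ^ 2) := by
  have hint : ∀ {x y : ℝ → E}, ContinuousOn x (Set.Icc (0:ℝ) T) →
      ContinuousOn y (Set.Icc (0:ℝ) T) →
      IntervalIntegrable (fun t => ⟪A (x t), y t⟫) MeasureTheory.volume 0 T := fun hx hy =>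
    ContinuousOn.intervalIntegrable_of_Icc hT ((A.continuous.comp_continuousOn hx).inner hy)
  have hX : 0 ≤ ∫ t in (0:ℝ)..T, ⟪A (v t), v t⟫ :=
    intervalIntegral.integral_nonneg hT fun t _ => hnonneg _
  set X := ∫ t in (0:ℝ)..T, ⟪A (v t), v t⟫
  set B := ∫ t in (0:ℝ)..T, ⟪A (w t), v t⟫
  set Y := ∫ t in (0:ℝ)..T, ⟪A (w t), w t⟫
  have hquad : ∀ s : ℝ, 0 ≤ (X + (1/2) * ‖a‖ ^ 2) * (s * s)
      + (2 * ((1/2) * ⟪a, b⟫ + B)) * s + (Y + (1/2) * ‖b‖ ^ 2) := by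
    intro s
    have h1 : 0 ≤ ∫ t in (0:ℝ)..T, ⟪A (s • v t + w t), s • v t + w t⟫ :=
      intervalIntegral.integral_nonneg hT fun t _ => hnonneg _
    have h2 : ∫ t in (0:ℝ)..T, ⟪A (s • v t + w t), s • v t + w t⟫
        = s * s * X + 2 * s * B + Y := by
      have h := fun t => inner_map_smul_add_self A.toLinearMap hsym s (v t) (w t)
      simp only [ContinuousLinearMap.coe_coe] at h
      simp only [h]
      rw [intervalIntegral.integral_add
        (((hint hv hv).const_mul _).add ((hint hw hv).const_mul _)) (hint hw hw),
        intervalIntegral.integral_add ((hint hv hv).const_mul _) ((hint hw hv).const_mul _),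
        intervalIntegral.integral_const_mul, intervalIntegral.integral_const_mul]
    have h3 : ‖s • a + b‖ ^ 2 = s * s * ‖a‖ ^ 2 + 2 * s * ⟪a, b⟫ + ‖b‖ ^ 2 := by
      rw [norm_add_sq_real, real_inner_smul_left, norm_smul, mul_pow, Real.norm_eq_abs, sq_abs]
      ring
    nlinarith [sq_nonneg ‖s • a + b‖]
  have hd := discrim_le_zero hquad
  rw [discrim] at hd
  rw [← Real.sqrt_mul (by positivity)]
  exact Real.abs_le_sqrt (by linarith)

end

/-- Finite-dimensional analogue of the continuity bound (2.15):
`|B((v,v_T),φ)| ≤ ‖(v,v_T)‖_Z ⬝ ‖φ‖_Y`. -/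
theorem stmt_1 (m : ℕ) (hm : 1 ≤ m)
    (A Ainv : EuclideanSpace ℝ (Fin m) →ₗ[ℝ] EuclideanSpace ℝ (Fin m))
    (hsym : ∀ x y, ⟪A x, y⟫ = ⟪x, A y⟫)
    (hpos : ∀ x, x ≠ 0 → 0 < ⟪A x, x⟫)
    (hinv1 : ∀ x, Ainv (A x) = x) (hinv2 : ∀ x, A (Ainv x) = x)
    (T : ℝ) (hT : 0 < T)
    (v : ℝ → EuclideanSpace ℝ (Fin m)) (hv : ContinuousOn v (Set.Icc (0:ℝ) T))
    (vT : EuclideanSpace ℝ (Fin m))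
    (φ φ' : ℝ → EuclideanSpace ℝ (Fin m))
    (hφ : ∀ t ∈ Set.Icc (0:ℝ) T, HasDerivWithinAt φ (φ' t) (Set.Icc (0:ℝ) T) t)
    (hφ' : ContinuousOn φ' (Set.Icc (0:ℝ) T)) :
    |⟪vT, φ T⟫ + ∫ t in (0:ℝ)..T, (-⟪φ' t, v t⟫ + ⟪A (φ t), v t⟫)|
      ≤ Real.sqrt ((∫ t in (0:ℝ)..T, ⟪A (v t), v t⟫) + (1/2) * ‖vT‖ ^ 2)
        * Real.sqrt ((∫ t in (0:ℝ)..T, (⟪Ainv (φ' t), φ' t⟫ + ⟪A (φ t), φ t⟫))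
            + ‖φ 0‖ ^ 2 + ‖φ T‖ ^ 2) := by
  have hnonneg : ∀ x, 0 ≤ ⟪A x, x⟫ := fun x => by
    rcases eq_or_ne x 0 with rfl | hx
    · simp
    · exact (hpos x hx).le
  have hc : ContinuousOn φ (Set.Icc (0:ℝ) T) := fun t ht => (hφ t ht).continuousWithinAt
  have hAc : Continuous A := A.continuous_of_finiteDimensional
  have hAic : Continuous Ainv := Ainv.continuous_of_finiteDimensional
  have hw : ContinuousOn (fun t => φ t - Ainv (φ' t)) (Set.Icc (0:ℝ) T) :=
    hc.sub (hAic.comp_continuousOn hφ')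
  have key := abs_integral_inner_map_add_le (LinearMap.toContinuousLinearMap A) hsym hnonneg
    hT.le hv hw vT ((2:ℝ) • φ T)
  simp only [LinearMap.coe_toContinuousLinearMap'] at key
  have hB : ∀ t, ⟪A (φ t - Ainv (φ' t)), v t⟫ = -⟪φ' t, v t⟫ + ⟪A (φ t), v t⟫ := fun t => by
    rw [map_sub, hinv2, inner_sub_left]
    ring
  have hY : ∀ t, ⟪A (φ t - Ainv (φ' t)), φ t - Ainv (φ' t)⟫
      = (⟪Ainv (φ' t), φ' t⟫ + ⟪A (φ t), φ t⟫) - 2 * ⟪φ' t, φ t⟫ := fun t => by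
    have h1 : ⟪A (φ t), Ainv (φ' t)⟫ = ⟪φ' t, φ t⟫ := by
      rw [hsym, hinv2, real_inner_comm]
    rw [map_sub, hinv2, inner_sub_left, inner_sub_right, inner_sub_right, h1,
      real_inner_comm (φ' t) (Ainv (φ' t))]
    ring
  have hYint : ∫ t in (0:ℝ)..T, ⟪A (φ t - Ainv (φ' t)), φ t - Ainv (φ' t)⟫
      = (∫ t in (0:ℝ)..T, (⟪Ainv (φ' t), φ' t⟫ + ⟪A (φ t), φ t⟫))
        - (‖φ T‖ ^ 2 - ‖φ 0‖ ^ 2) := by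
    simp only [hY]
    rw [intervalIntegral.integral_sub, integral_inner_deriv_self hT.le hφ hφ']
    · exact ContinuousOn.intervalIntegrable_of_Icc hT.le
        (((hAic.comp_continuousOn hφ').inner hφ').add ((hAc.comp_continuousOn hc).inner hc))
    · exact ContinuousOn.intervalIntegrable_of_Icc hT.le
        (continuousOn_const.mul (hφ'.inner hc))
  rw [hYint] at key
  simp only [hB] at key
  rw [real_inner_smul_right, norm_smul, mul_pow, Real.norm_eq_abs, sq_abs] at key
  convert key using 3 <;> ring
end

section
/- Finite-dimensional analogue of the first inf-sup identity (2.13a) of Theorem 2.2: for every continuous v : [0,T] → ℝ^m and every v_T ∈ ℝ^m, the number ‖(v,v_T)‖_Z is the greatest element of the set { B((v,v_T),φ)/‖φ‖_Y : φ ∈ C¹([0,T];ℝ^m), φ not identically zero }; in particular the supremum over all nonzero test functions φ of B((v,v_T),φ)/‖φ‖_Y equals ‖(v,v_T)‖_Z and is attained. -/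
open scoped RealInnerProductSpace

section InfSup

variable {E : Type*} [NormedAddCommGroup E] [InnerProductSpace ℝ E]

/-- The backward problem `φ' = L φ - g`, `φ(T) = a`, is solvable by variation of constants. -/
theorem exists_hasDerivAt_backward [CompleteSpace E] (L : E →L[ℝ] E) {g : ℝ → E}
    (hg : Continuous g) (T : ℝ) (a : E) :
    ∃ φ : ℝ → E, φ T = a ∧ ∀ t, HasDerivAt φ (L (φ t) - g t) t := by
  have hexp (t : ℝ) : HasDerivAt (fun s : ℝ => NormedSpace.exp (s • L))
      (L * NormedSpace.exp (t • L)) t := hasDerivAt_exp_smul_const' L t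
  have hmul (t : ℝ) : NormedSpace.exp (t • L) * NormedSpace.exp ((-t) • L) = 1 := by
    let _ : NormedAlgebra ℚ (E →L[ℝ] E) := NormedAlgebra.restrictScalars ℚ ℝ _
    rw [← NormedSpace.exp_add_of_commute
      (((Commute.refl L).smul_left t).smul_right (-t)), ← add_smul]
    simp
  have hcont : Continuous fun s : ℝ => NormedSpace.exp ((-s) • L) (g s) := by
    have h : Continuous fun s : ℝ => NormedSpace.exp (s • L) :=
      continuous_iff_continuousAt.2 fun t => (hexp t).continuousAt
    exact (h.comp continuous_neg).clm_apply hg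
  refine ⟨fun t => NormedSpace.exp (t • L) (NormedSpace.exp ((-T) • L) a
    - ∫ s in T..t, NormedSpace.exp ((-s) • L) (g s)), ?_, fun t => ?_⟩
  · have h := congrArg (fun F : E →L[ℝ] E => F a) (hmul T)
    simpa using h
  · have hInt := intervalIntegral.integral_hasDerivAt_right (hcont.intervalIntegrable T t)
      hcont.stronglyMeasurable.stronglyMeasurableAtFilter hcont.continuousAt
    have h := (hexp t).clm_apply (hInt.const_sub (NormedSpace.exp ((-T) • L) a))
    have hcancel := congrArg (fun F : E →L[ℝ] E => F (g t)) (hmul t)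
    simp only [mul_apply_eq_comp, one_apply_eq_self] at hcancel
    refine h.congr_deriv ?_
    rw [map_neg, hcancel, mul_apply_eq_comp, ← sub_eq_add_neg]

/-- Expansion of `∫ ⟪A (w - c v), w - c v⟫` for `w = φ - A⁻¹ φ'`, in which the cross term
`2 ∫ ⟪φ', φ⟫` is integrated exactly. -/
theorem integral_inner_sub_smul [FiniteDimensional ℝ E] (A Ainv : E →ₗ[ℝ] E)
    (hsym : ∀ x y, ⟪A x, y⟫ = ⟪x, A y⟫) (hinv : ∀ x, A (Ainv x) = x)
    {T : ℝ} (hT : 0 ≤ T) {v φ φ' : ℝ → E} (hv : ContinuousOn v (Set.Icc 0 T))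
    (hφ : ∀ t ∈ Set.Icc 0 T, HasDerivWithinAt φ (φ' t) (Set.Icc 0 T) t)
    (hφ' : ContinuousOn φ' (Set.Icc 0 T)) (c : ℝ) :
    ∫ t in (0:ℝ)..T, ⟪A (φ t - Ainv (φ' t) - c • v t), φ t - Ainv (φ' t) - c • v t⟫ =
      (∫ t in (0:ℝ)..T, (⟪Ainv (φ' t), φ' t⟫ + ⟪A (φ t), φ t⟫)) - (‖φ T‖ ^ 2 - ‖φ 0‖ ^ 2)
        - 2 * c * (∫ t in (0:ℝ)..T, (-⟪φ' t, v t⟫ + ⟪A (φ t), v t⟫))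
        + c ^ 2 * ∫ t in (0:ℝ)..T, ⟪A (v t), v t⟫ := by
  have hφc : ContinuousOn φ (Set.Icc 0 T) := fun t ht => (hφ t ht).continuousWithinAt
  have hA : Continuous A := A.continuous_of_finiteDimensional
  have hAinv : Continuous Ainv := Ainv.continuous_of_finiteDimensional
  have hInt {f : ℝ → ℝ} (hf : ContinuousOn f (Set.Icc 0 T)) :
      IntervalIntegrable f MeasureTheory.volume 0 T :=
    ContinuousOn.intervalIntegrable_of_Icc hT hf
  have hAφ := hA.comp_continuousOn hφc
  have hN : IntervalIntegrable (fun t => ⟪Ainv (φ' t), φ' t⟫ + ⟪A (φ t), φ t⟫)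
      MeasureTheory.volume 0 T := hInt (((hAinv.comp_continuousOn hφ').inner hφ').add (hAφ.inner hφc))
  have hD : IntervalIntegrable (fun t => 2 * ⟪φ t, φ' t⟫) MeasureTheory.volume 0 T :=
    hInt (continuousOn_const.mul (hφc.inner hφ'))
  have hB : IntervalIntegrable (fun t => -⟪φ' t, v t⟫ + ⟪A (φ t), v t⟫)
      MeasureTheory.volume 0 T := hInt ((hφ'.inner hv).neg.add (hAφ.inner hv))
  have hV : IntervalIntegrable (fun t => ⟪A (v t), v t⟫) MeasureTheory.volume 0 T :=
    hInt ((hA.comp_continuousOn hv).inner hv)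
  have henergy : ∫ t in (0:ℝ)..T, 2 * ⟪φ t, φ' t⟫ = ‖φ T‖ ^ 2 - ‖φ 0‖ ^ 2 :=
    intervalIntegral.integral_eq_sub_of_hasDerivAt_of_le hT (hφc.norm.pow 2)
      (fun t ht => ((hφ t (Set.Ioo_subset_Icc_self ht)).hasDerivAt
        (Icc_mem_nhds ht.1 ht.2)).norm_sq) hD
  rw [← henergy, ← intervalIntegral.integral_const_mul, ← intervalIntegral.integral_const_mul,
    ← intervalIntegral.integral_sub hN hD,
    ← intervalIntegral.integral_sub (hN.sub hD) (hB.const_mul _),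
    ← intervalIntegral.integral_add ((hN.sub hD).sub (hB.const_mul _)) (hV.const_mul _)]
  refine intervalIntegral.integral_congr fun t _ => ?_
  have h1 : ⟪A (φ t), Ainv (φ' t)⟫ = ⟪φ t, φ' t⟫ := by rw [hsym, hinv]
  have h2 : ⟪A (v t), Ainv (φ' t)⟫ = ⟪φ' t, v t⟫ := by rw [hsym, hinv, real_inner_comm]
  have h3 : ⟪A (v t), φ t⟫ = ⟪A (φ t), v t⟫ := by rw [hsym, real_inner_comm]
  simp only [map_sub, map_smul, hinv, inner_sub_left, inner_sub_right, real_inner_smul_left,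
    real_inner_smul_right, h1, h2, h3, real_inner_comm (φ t) (φ' t),
    real_inner_comm (Ainv (φ' t)) (φ' t)]
  ring

end InfSup

/-- Finite-dimensional analogue of the first inf-sup identity (2.13a):
`‖(v,v_T)‖_Z` is the greatest element of `{ B((v,v_T),φ)/‖φ‖_Y : φ ∈ C¹([0,T];ℝᵐ), φ ≢ 0 }`. -/
theorem stmt_2 (m : ℕ) (hm : 1 ≤ m)
    (A Ainv : EuclideanSpace ℝ (Fin m) →ₗ[ℝ] EuclideanSpace ℝ (Fin m))
    (hsym : ∀ x y, ⟪A x, y⟫ = ⟪x, A y⟫)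
    (hpos : ∀ x, x ≠ 0 → 0 < ⟪A x, x⟫)
    (hinv1 : ∀ x, Ainv (A x) = x) (hinv2 : ∀ x, A (Ainv x) = x)
    (T : ℝ) (hT : 0 < T)
    (v : ℝ → EuclideanSpace ℝ (Fin m)) (hv : ContinuousOn v (Set.Icc (0:ℝ) T))
    (vT : EuclideanSpace ℝ (Fin m)) :
    IsGreatest
      { r : ℝ | ∃ φ φ' : ℝ → EuclideanSpace ℝ (Fin m),
          (∀ t ∈ Set.Icc (0:ℝ) T, HasDerivWithinAt φ (φ' t) (Set.Icc (0:ℝ) T) t) ∧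
          ContinuousOn φ' (Set.Icc (0:ℝ) T) ∧
          (∃ t ∈ Set.Icc (0:ℝ) T, φ t ≠ 0) ∧
          r = (⟪vT, φ T⟫ + ∫ t in (0:ℝ)..T, (-⟪φ' t, v t⟫ + ⟪A (φ t), v t⟫))
              / Real.sqrt ((∫ t in (0:ℝ)..T, (⟪Ainv (φ' t), φ' t⟫ + ⟪A (φ t), φ t⟫))
                  + ‖φ 0‖ ^ 2 + ‖φ T‖ ^ 2) }
      (Real.sqrt ((∫ t in (0:ℝ)..T, ⟪A (v t), v t⟫) + (1/2) * ‖vT‖ ^ 2)) := by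
  have hAnn (x) : 0 ≤ ⟪A x, x⟫ := by
    rcases eq_or_ne x 0 with rfl | hx
    · simp
    · exact (hpos x hx).le
  have h0T : (0:ℝ) ∈ Set.Icc 0 T := Set.left_mem_Icc.2 hT.le
  constructor
  · by_cases hzero : vT = 0 ∧ ∀ t ∈ Set.Icc (0:ℝ) T, v t = 0
    · obtain ⟨hvT, hv0⟩ := hzero
      have : Nonempty (Fin m) := ⟨⟨0, hm⟩⟩
      obtain ⟨e, he⟩ := exists_ne (0 : EuclideanSpace ℝ (Fin m))
      refine ⟨fun _ => e, fun _ => 0, fun t _ => hasDerivWithinAt_const _ _ _,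
        continuousOn_const, ⟨0, h0T, he⟩, ?_⟩
      have hV : ∫ t in (0:ℝ)..T, ⟪A (v t), v t⟫ = ∫ t in (0:ℝ)..T, (0:ℝ) :=
        intervalIntegral.integral_congr fun t ht => by
          rw [Set.uIcc_of_le hT.le] at ht
          simp [hv0 t ht]
      have hB : ∫ t in (0:ℝ)..T, (-⟪(0 : EuclideanSpace ℝ (Fin m)), v t⟫ + ⟪A e, v t⟫) =
          ∫ t in (0:ℝ)..T, (0:ℝ) :=
        intervalIntegral.integral_congr fun t ht => by
          rw [Set.uIcc_of_le hT.le] at ht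
          simp [hv0 t ht]
      rw [hV, hB, hvT]
      simp
    · have hg : Continuous fun t => A (Set.IccExtend hT.le (Set.domRestrict (Set.Icc 0 T) v) t) :=
        A.continuous_of_finiteDimensional.comp hv.domRestrict.Icc_extend'
      obtain ⟨φ, hφT, hφ⟩ := exists_hasDerivAt_backward (LinearMap.toContinuousLinearMap A) hg T
        ((1/2 : ℝ) • vT)
      have hderiv : ∀ t ∈ Set.Icc (0:ℝ) T,
          HasDerivWithinAt φ (A (φ t) - A (v t)) (Set.Icc 0 T) t := fun t ht => by
        have h := (hφ t).hasDerivWithinAt (s := Set.Icc 0 T)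
        rwa [Set.IccExtend_of_mem hT.le _ ht] at h
      have hφc : ContinuousOn φ (Set.Icc 0 T) := fun t ht => (hderiv t ht).continuousWithinAt
      have hA : Continuous A := A.continuous_of_finiteDimensional
      have hφ'c : ContinuousOn (fun t => A (φ t) - A (v t)) (Set.Icc 0 T) :=
        (hA.comp_continuousOn hφc).sub (hA.comp_continuousOn hv)
      refine ⟨φ, fun t => A (φ t) - A (v t), hderiv, hφ'c, ?_, ?_⟩
      · by_contra! hφ0
        refine hzero ⟨?_, fun t ht => ?_⟩
        · simpa [hφ0 T (Set.right_mem_Icc.2 hT.le)] using hφT.symm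
        · have h0 : HasDerivWithinAt φ 0 (Set.Icc 0 T) t :=
            (hasDerivWithinAt_const t _ (0 : EuclideanSpace ℝ (Fin m))).congr hφ0 (hφ0 t ht)
          have h := (uniqueDiffOn_Icc hT t ht).eq_deriv _ (hderiv t ht) h0
          rw [hφ0 t ht, map_zero, zero_sub, neg_eq_zero] at h
          rw [← hinv1 (v t), h, map_zero]
      · have e0 := integral_inner_sub_smul A Ainv hsym hinv2 hT.le hv hderiv hφ'c 0
        have e1 := integral_inner_sub_smul A Ainv hsym hinv2 hT.le hv hderiv hφ'c 1
        simp only [map_sub, hinv1, sub_sub_cancel, zero_smul, one_smul, sub_zero, sub_self,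
          inner_zero_right, intervalIntegral.integral_zero] at e0 e1
        have hnorm : ‖φ T‖ ^ 2 = (1/4) * ‖vT‖ ^ 2 := by
          rw [hφT, norm_smul, mul_pow]
          norm_num
        have hinner : ⟪vT, φ T⟫ = (1/2) * ‖vT‖ ^ 2 := by
          rw [hφT, real_inner_smul_right, real_inner_self_eq_norm_sq]
        rw [← Real.div_sqrt]
        simp only [map_sub, hinv1]
        congr 1
        · linarith
        · congr 1
          linarith
  · rintro r ⟨φ, φ', hφ, hφ', -, rfl⟩
    have hquad (c : ℝ) := integral_inner_sub_smul A Ainv hsym hinv2 hT.le hv hφ hφ' c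
    set N := ∫ t in (0:ℝ)..T, (⟪Ainv (φ' t), φ' t⟫ + ⟪A (φ t), φ t⟫)
    set I := ∫ t in (0:ℝ)..T, (-⟪φ' t, v t⟫ + ⟪A (φ t), v t⟫)
    set V := ∫ t in (0:ℝ)..T, ⟪A (v t), v t⟫
    have hdisc := discrim_le_zero (a := V + (1/2) * ‖vT‖ ^ 2) (b := -2 * (⟪vT, φ T⟫ + I))
      (c := N + ‖φ 0‖ ^ 2 + ‖φ T‖ ^ 2) fun c => by
        have h1 := intervalIntegral.integral_nonneg hT.le (μ := MeasureTheory.volume)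
          fun t _ => hAnn (φ t - Ainv (φ' t) - c • v t)
        have h2 := sq_nonneg ‖φ T - (c / 2) • vT‖
        rw [norm_sub_sq_real, norm_smul, mul_pow, Real.norm_eq_abs, sq_abs,
          real_inner_smul_right, real_inner_comm] at h2
        rw [hquad] at h1
        linarith
    have hV : 0 ≤ V + (1/2) * ‖vT‖ ^ 2 :=
      add_nonneg (intervalIntegral.integral_nonneg hT.le fun t _ => hAnn (v t)) (by positivity)
    refine div_le_of_le_mul₀ (Real.sqrt_nonneg _) (Real.sqrt_nonneg _) ?_
    rw [← Real.sqrt_mul hV]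
    apply Real.le_sqrt_of_sq_le
    rw [discrim] at hdisc
    linarith
end

section
/- Finite-dimensional analogue of the second inf-sup identity (2.13b) of Theorem 2.2: for every continuously differentiable φ : [0,T] → ℝ^m, the number ‖φ‖_Y is the greatest element of the set { B((v,v_T),φ)/‖(v,v_T)‖_Z : v : [0,T] → ℝ^m continuous, v_T ∈ ℝ^m, not both v ≡ 0 and v_T = 0 }; in particular the supremum over all such nonzero pairs (v,v_T) of B((v,v_T),φ)/‖(v,v_T)‖_Z equals ‖φ‖_Y and is attained. -/
open scoped RealInnerProductSpace

section EnergyForm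

variable {m : ℕ} {T : ℝ}

/-- For a continuously differentiable curve, `∫₀ᵀ 2⟪φ', φ⟫ = ‖φ(T)‖² - ‖φ(0)‖²`. -/
lemma integral_two_mul_inner_deriv (hT : 0 ≤ T) {φ φ' : ℝ → EuclideanSpace ℝ (Fin m)}
    (hφ : ∀ t ∈ Set.Icc (0:ℝ) T, HasDerivWithinAt φ (φ' t) (Set.Icc (0:ℝ) T) t)
    (hφ' : ContinuousOn φ' (Set.Icc (0:ℝ) T)) :
    ∫ t in (0:ℝ)..T, 2 * ⟪φ' t, φ t⟫ = ‖φ T‖ ^ 2 - ‖φ 0‖ ^ 2 := by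
  have hc : ContinuousOn φ (Set.Icc 0 T) := fun t ht => (hφ t ht).continuousWithinAt
  refine intervalIntegral.integral_eq_sub_of_hasDerivAt_of_le (f := fun t => ‖φ t‖ ^ 2) hT
    (hc.norm.pow 2) (fun t ht => ?_) ?_
  · have h := ((hφ t (Set.Ioo_subset_Icc_self ht)).hasDerivAt
      (Icc_mem_nhds ht.1 ht.2)).norm_sq
    rwa [real_inner_comm] at h
  · apply ContinuousOn.intervalIntegrable
    rw [Set.uIcc_of_le hT]
    exact continuousOn_const.mul (hφ'.inner hc)

/-- Cauchy–Schwarz inequality for the semi-inner product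
`∫₀ᵀ ⟪A u, v⟫ + ½ ⟪u_T, v_T⟫` on pairs of a continuous curve and a vector. -/
lemma sq_integral_inner_add_le (hT : 0 ≤ T)
    {A : EuclideanSpace ℝ (Fin m) →ₗ[ℝ] EuclideanSpace ℝ (Fin m)}
    (hsym : ∀ x y, ⟪A x, y⟫ = ⟪x, A y⟫) (hA : ∀ x, 0 ≤ ⟪A x, x⟫)
    {u v : ℝ → EuclideanSpace ℝ (Fin m)} (hu : ContinuousOn u (Set.Icc 0 T))
    (hv : ContinuousOn v (Set.Icc 0 T)) (uT vT : EuclideanSpace ℝ (Fin m)) :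
    ((∫ t in (0:ℝ)..T, ⟪A (u t), v t⟫) + (1/2) * ⟪uT, vT⟫) ^ 2 ≤
      ((∫ t in (0:ℝ)..T, ⟪A (u t), u t⟫) + (1/2) * ‖uT‖ ^ 2) *
      ((∫ t in (0:ℝ)..T, ⟪A (v t), v t⟫) + (1/2) * ‖vT‖ ^ 2) := by
  have hcont : Continuous A := A.continuous_of_finiteDimensional
  have hint {x y : ℝ → EuclideanSpace ℝ (Fin m)} (hx : ContinuousOn x (Set.Icc 0 T))
      (hy : ContinuousOn y (Set.Icc 0 T)) :
      IntervalIntegrable (fun t => ⟪A (x t), y t⟫) MeasureTheory.volume 0 T := by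
    apply ContinuousOn.intervalIntegrable
    rw [Set.uIcc_of_le hT]
    exact (hcont.comp_continuousOn hx).inner hy
  have hquad (s : ℝ) :
      0 ≤ ((∫ t in (0:ℝ)..T, ⟪A (v t), v t⟫) + (1/2) * ‖vT‖ ^ 2) * (s * s)
        + (-2 * ((∫ t in (0:ℝ)..T, ⟪A (u t), v t⟫) + (1/2) * ⟪uT, vT⟫)) * s
        + ((∫ t in (0:ℝ)..T, ⟪A (u t), u t⟫) + (1/2) * ‖uT‖ ^ 2) := by
    have hexp : ∀ t, ⟪A (u t - s • v t), u t - s • v t⟫ =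
        ⟪A (u t), u t⟫ - (2 * s) * ⟪A (u t), v t⟫ + (s * s) * ⟪A (v t), v t⟫ := fun t => by
      have hvu : ⟪A (v t), u t⟫ = ⟪A (u t), v t⟫ := by rw [hsym, real_inner_comm]
      simp only [map_sub, map_smul, inner_sub_left, inner_sub_right, real_inner_smul_left,
        real_inner_smul_right, hvu]
      ring
    have h1 : 0 ≤ ∫ t in (0:ℝ)..T, ⟪A (u t - s • v t), u t - s • v t⟫ :=
      intervalIntegral.integral_nonneg hT fun t _ => hA _
    simp only [hexp] at h1
    rw [intervalIntegral.integral_add ((hint hu hu).sub ((hint hu hv).const_mul _))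
        ((hint hv hv).const_mul _),
      intervalIntegral.integral_sub (hint hu hu) ((hint hu hv).const_mul _),
      intervalIntegral.integral_const_mul, intervalIntegral.integral_const_mul] at h1
    have h2 : 0 ≤ ‖uT - s • vT‖ ^ 2 := sq_nonneg _
    rw [norm_sub_sq_real, real_inner_smul_right, norm_smul, mul_pow, Real.norm_eq_abs,
      sq_abs] at h2
    linarith
  have hd := discrim_le_zero hquad
  rw [discrim] at hd
  linarith

end EnergyForm

/-- Finite-dimensional analogue of the second inf-sup identity (2.13b):
`‖φ‖_Y` is the greatest element of
`{ B((v,v_T),φ)/‖(v,v_T)‖_Z : v continuous, v_T ∈ ℝᵐ, (v,v_T) ≠ 0 }`. -/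
theorem stmt_3 (m : ℕ) (hm : 1 ≤ m)
    (A Ainv : EuclideanSpace ℝ (Fin m) →ₗ[ℝ] EuclideanSpace ℝ (Fin m))
    (hsym : ∀ x y, ⟪A x, y⟫ = ⟪x, A y⟫)
    (hpos : ∀ x, x ≠ 0 → 0 < ⟪A x, x⟫)
    (hinv1 : ∀ x, Ainv (A x) = x) (hinv2 : ∀ x, A (Ainv x) = x)
    (T : ℝ) (hT : 0 < T)
    (φ φ' : ℝ → EuclideanSpace ℝ (Fin m))
    (hφ : ∀ t ∈ Set.Icc (0:ℝ) T, HasDerivWithinAt φ (φ' t) (Set.Icc (0:ℝ) T) t)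
    (hφ' : ContinuousOn φ' (Set.Icc (0:ℝ) T)) :
    IsGreatest
      { r : ℝ | ∃ (v : ℝ → EuclideanSpace ℝ (Fin m)) (vT : EuclideanSpace ℝ (Fin m)),
          ContinuousOn v (Set.Icc (0:ℝ) T) ∧
          ¬((∀ t ∈ Set.Icc (0:ℝ) T, v t = 0) ∧ vT = 0) ∧
          r = (⟪vT, φ T⟫ + ∫ t in (0:ℝ)..T, (-⟪φ' t, v t⟫ + ⟪A (φ t), v t⟫))
              / Real.sqrt ((∫ t in (0:ℝ)..T, ⟪A (v t), v t⟫) + (1/2) * ‖vT‖ ^ 2) }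
      (Real.sqrt ((∫ t in (0:ℝ)..T, (⟪Ainv (φ' t), φ' t⟫ + ⟪A (φ t), φ t⟫))
          + ‖φ 0‖ ^ 2 + ‖φ T‖ ^ 2)) := by
  have hA : ∀ x, 0 ≤ ⟪A x, x⟫ := fun x => by
    rcases eq_or_ne x 0 with rfl | hx
    · simp
    · exact (hpos x hx).le
  have hcA : Continuous A := A.continuous_of_finiteDimensional
  have hcAinv : Continuous Ainv := Ainv.continuous_of_finiteDimensional
  have hφc : ContinuousOn φ (Set.Icc 0 T) := fun t ht => (hφ t ht).continuousWithinAt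
  set w : ℝ → EuclideanSpace ℝ (Fin m) := fun t => φ t - Ainv (φ' t) with hw
  have hwc : ContinuousOn w (Set.Icc 0 T) := hφc.sub (hcAinv.comp_continuousOn hφ')
  have hAw (t : ℝ) (y : EuclideanSpace ℝ (Fin m)) :
      -⟪φ' t, y⟫ + ⟪A (φ t), y⟫ = ⟪A (w t), y⟫ := by
    simp only [hw, map_sub, hinv2, inner_sub_left]
    ring
  have hww (t : ℝ) : ⟪A (w t), w t⟫ =
      (⟪Ainv (φ' t), φ' t⟫ + ⟪A (φ t), φ t⟫) - 2 * ⟪φ' t, φ t⟫ := by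
    have h1 : ⟪A (φ t), Ainv (φ' t)⟫ = ⟪φ' t, φ t⟫ := by
      rw [hsym, hinv2, real_inner_comm]
    have h2 : ⟪φ' t, Ainv (φ' t)⟫ = ⟪Ainv (φ' t), φ' t⟫ := real_inner_comm _ _
    simp only [hw, map_sub, hinv2, inner_sub_left, inner_sub_right, h1, h2]
    ring
  have hnorm : (∫ t in (0:ℝ)..T, (⟪Ainv (φ' t), φ' t⟫ + ⟪A (φ t), φ t⟫))
      + ‖φ 0‖ ^ 2 + ‖φ T‖ ^ 2 = (∫ t in (0:ℝ)..T, ⟪A (w t), w t⟫)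
      + (1/2) * ‖(2:ℝ) • φ T‖ ^ 2 := by
    simp only [hww]
    rw [intervalIntegral.integral_sub, integral_two_mul_inner_deriv hT.le hφ hφ', norm_smul,
      Real.norm_two]
    · ring
    all_goals
      apply ContinuousOn.intervalIntegrable
      rw [Set.uIcc_of_le hT.le]
    · exact ((hcAinv.comp_continuousOn hφ').inner hφ').add ((hcA.comp_continuousOn hφc).inner hφc)
    · exact continuousOn_const.mul (hφ'.inner hφc)
  rw [hnorm]
  simp only [hAw]
  have hI : 0 ≤ ∫ t in (0:ℝ)..T, ⟪A (w t), w t⟫ :=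
    intervalIntegral.integral_nonneg hT.le fun t _ => hA _
  constructor
  · by_cases h0 : (∀ t ∈ Set.Icc (0:ℝ) T, w t = 0) ∧ (2:ℝ) • φ T = 0
    · have : Nonempty (Fin m) := ⟨⟨0, hm⟩⟩
      obtain ⟨x, hx⟩ := exists_ne (0 : EuclideanSpace ℝ (Fin m))
      refine ⟨fun _ => 0, x, continuousOn_const, fun h => hx h.2, ?_⟩
      have hφT : φ T = 0 := (smul_eq_zero_iff_right two_ne_zero).1 h0.2
      have hwI : ∫ t in (0:ℝ)..T, ⟪A (w t), w t⟫ = 0 := by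
        refine (intervalIntegral.integral_congr (g := fun _ => (0:ℝ)) fun t ht => ?_).trans
          intervalIntegral.integral_zero
        rw [Set.uIcc_of_le hT.le] at ht
        simp [h0.1 t ht]
      simp [hφT, hwI]
    · refine ⟨w, (2:ℝ) • φ T, hwc, h0, ?_⟩
      have hnum : ⟪(2:ℝ) • φ T, φ T⟫ = (1/2) * ‖(2:ℝ) • φ T‖ ^ 2 := by
        rw [real_inner_smul_left, real_inner_self_eq_norm_sq, norm_smul, Real.norm_two]
        ring
      rw [hnum, add_comm, Real.div_sqrt]
  · rintro r ⟨v, vT, hv, -, rfl⟩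
    refine div_le_of_le_mul₀ (Real.sqrt_nonneg _) (Real.sqrt_nonneg _) ?_
    rw [← Real.sqrt_mul (by positivity)]
    apply Real.le_sqrt_of_sq_le
    convert sq_integral_inner_add_le hT.le hsym hA hwc hv ((2:ℝ) • φ T) vT using 2
    rw [real_inner_smul_left, real_inner_comm]
    ring
end

section
/- Finite-dimensional analogue of the energy-norm characterization (2.22): let f : [0,T] → ℝ^m be continuous, u_0 ∈ ℝ^m, and let u ∈ C¹([0,T];ℝ^m) satisfy u'(t) + Au(t) = f(t) for all t ∈ [0,T] and u(0) = u_0. Then the energy norm of the solution, (½‖u(T)‖² + ∫₀^T ⟨Au(t),u(t)⟩ dt)^{1/2}, is the greatest element of the set { (∫₀^T ⟨f(t),φ(t)⟩ dt + ⟨u_0, φ(0)⟩) / ‖φ‖_Y : φ ∈ C¹([0,T];ℝ^m), φ not identically zero }. -/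
open scoped RealInnerProductSpace

open Set

namespace EnergyNorm

variable {E : Type*} [NormedAddCommGroup E] [InnerProductSpace ℝ E]

/-- Integration by parts for the inner product of two `C¹` curves on `[0, T]`. -/
theorem integral_inner_deriv_add {T : ℝ} (hT : 0 < T) {u u' φ φ' : ℝ → E}
    (hu : ∀ t ∈ Icc (0:ℝ) T, HasDerivWithinAt u (u' t) (Icc (0:ℝ) T) t)
    (hu' : ContinuousOn u' (Icc (0:ℝ) T))
    (hφ : ∀ t ∈ Icc (0:ℝ) T, HasDerivWithinAt φ (φ' t) (Icc (0:ℝ) T) t)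
    (hφ' : ContinuousOn φ' (Icc (0:ℝ) T)) :
    ∫ t in (0:ℝ)..T, (⟪u t, φ' t⟫ + ⟪u' t, φ t⟫) = ⟪u T, φ T⟫ - ⟪u 0, φ 0⟫ := by
  have hcu : ContinuousOn u (Icc (0:ℝ) T) := fun t ht => (hu t ht).continuousWithinAt
  have hcφ : ContinuousOn φ (Icc (0:ℝ) T) := fun t ht => (hφ t ht).continuousWithinAt
  refine intervalIntegral.integral_eq_sub_of_hasDerivAt_of_le
    (f := fun t => ⟪u t, φ t⟫) hT.le (hcu.inner hcφ) (fun t ht => ?_) ?_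
  · have hn : Icc (0:ℝ) T ∈ nhds t := Icc_mem_nhds ht.1 ht.2
    have ht' := Ioo_subset_Icc_self ht
    exact ((hu t ht').hasDerivAt hn).inner ℝ ((hφ t ht').hasDerivAt hn)
  · apply ContinuousOn.intervalIntegrable
    rw [uIcc_of_le hT.le]
    exact (hcu.inner hφ').add (hu'.inner hcφ)

/-- Weak form of `u' + A u = f` with the adjoint operator moved onto the test curve. -/
theorem integral_inner_source_add {T : ℝ} (hT : 0 < T) {A Ainv : E →L[ℝ] E}
    (hsym : ∀ x y, ⟪A x, y⟫ = ⟪x, A y⟫) (hinv : ∀ x, A (Ainv x) = x)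
    {f u φ φ' : ℝ → E} (hf : ContinuousOn f (Icc (0:ℝ) T))
    (hu : ∀ t ∈ Icc (0:ℝ) T, HasDerivWithinAt u (f t - A (u t)) (Icc (0:ℝ) T) t)
    (hφ : ∀ t ∈ Icc (0:ℝ) T, HasDerivWithinAt φ (φ' t) (Icc (0:ℝ) T) t)
    (hφ' : ContinuousOn φ' (Icc (0:ℝ) T)) :
    (∫ t in (0:ℝ)..T, ⟪f t, φ t⟫) + ⟪u 0, φ 0⟫
      = (∫ t in (0:ℝ)..T, ⟪A (u t), φ t - Ainv (φ' t)⟫) + ⟪u T, φ T⟫ := by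
  have hcu : ContinuousOn u (Icc (0:ℝ) T) := fun t ht => (hu t ht).continuousWithinAt
  have hcφ : ContinuousOn φ (Icc (0:ℝ) T) := fun t ht => (hφ t ht).continuousWithinAt
  have hcA : ContinuousOn (fun t => A (u t)) (Icc (0:ℝ) T) := A.continuous.comp_continuousOn hcu
  have hcI : ContinuousOn (fun t => Ainv (φ' t)) (Icc (0:ℝ) T) :=
    Ainv.continuous.comp_continuousOn hφ'
  have hparts := integral_inner_deriv_add hT hu (hf.sub hcA) hφ hφ'
  have hsum : (∫ t in (0:ℝ)..T, ⟪f t, φ t⟫)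
      = (∫ t in (0:ℝ)..T, ⟪A (u t), φ t - Ainv (φ' t)⟫)
        + ∫ t in (0:ℝ)..T, (⟪u t, φ' t⟫ + ⟪f t - A (u t), φ t⟫) := by
    rw [← intervalIntegral.integral_add]
    · congr 1
      ext t
      rw [inner_sub_right, inner_sub_left, hsym (u t) (Ainv (φ' t)), hinv]
      ring
    all_goals
      apply ContinuousOn.intervalIntegrable
      rw [uIcc_of_le hT.le]
    · exact hcA.inner (hcφ.sub hcI)
    · exact (hcu.inner hφ').add ((hf.sub hcA).inner hcφ)
  rw [hsum, hparts]
  ring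

/-- The square of the `Y`-norm in terms of `φ - A⁻¹ φ'` and the final value. -/
theorem integral_energy_add_norm_sq {T : ℝ} (hT : 0 < T) {A Ainv : E →L[ℝ] E}
    (hsym : ∀ x y, ⟪A x, y⟫ = ⟪x, A y⟫) (hinv : ∀ x, A (Ainv x) = x)
    {φ φ' : ℝ → E}
    (hφ : ∀ t ∈ Icc (0:ℝ) T, HasDerivWithinAt φ (φ' t) (Icc (0:ℝ) T) t)
    (hφ' : ContinuousOn φ' (Icc (0:ℝ) T)) :
    (∫ t in (0:ℝ)..T, (⟪Ainv (φ' t), φ' t⟫ + ⟪A (φ t), φ t⟫)) + ‖φ 0‖ ^ 2 + ‖φ T‖ ^ 2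
      = (∫ t in (0:ℝ)..T, ⟪A (φ t - Ainv (φ' t)), φ t - Ainv (φ' t)⟫) + 2 * ‖φ T‖ ^ 2 := by
  have hcφ : ContinuousOn φ (Icc (0:ℝ) T) := fun t ht => (hφ t ht).continuousWithinAt
  have hcI : ContinuousOn (fun t => Ainv (φ' t)) (Icc (0:ℝ) T) :=
    Ainv.continuous.comp_continuousOn hφ'
  have hparts := integral_inner_deriv_add hT hφ hφ' hφ hφ'
  have hsum : (∫ t in (0:ℝ)..T, (⟪Ainv (φ' t), φ' t⟫ + ⟪A (φ t), φ t⟫))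
      = (∫ t in (0:ℝ)..T, ⟪A (φ t - Ainv (φ' t)), φ t - Ainv (φ' t)⟫)
        + ∫ t in (0:ℝ)..T, (⟪φ t, φ' t⟫ + ⟪φ' t, φ t⟫) := by
    rw [← intervalIntegral.integral_add]
    · congr 1
      ext t
      rw [map_sub, hinv, inner_sub_right, inner_sub_left, inner_sub_left,
        hsym (φ t) (Ainv (φ' t)), hinv, real_inner_comm (Ainv (φ' t)) (φ' t)]
      ring
    all_goals
      apply ContinuousOn.intervalIntegrable
      rw [uIcc_of_le hT.le]
    · exact (A.continuous.comp_continuousOn (hcφ.sub hcI)).inner (hcφ.sub hcI)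
    · exact (hcφ.inner hφ').add (hφ'.inner hcφ)
  rw [hsum, hparts, real_inner_self_eq_norm_sq, real_inner_self_eq_norm_sq]
  ring

/-- Cauchy–Schwarz for the energy inner product augmented by a weighted final value. -/
theorem sq_integral_inner_add_le {T : ℝ} (hT : 0 ≤ T) {A : E →L[ℝ] E}
    (hsym : ∀ x y, ⟪A x, y⟫ = ⟪x, A y⟫) (hnonneg : ∀ x, 0 ≤ ⟪A x, x⟫)
    {u w : ℝ → E} (hu : ContinuousOn u (Icc (0:ℝ) T)) (hw : ContinuousOn w (Icc (0:ℝ) T))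
    (a b : E) :
    ((∫ t in (0:ℝ)..T, ⟪A (u t), w t⟫) + ⟪a, b⟫) ^ 2
      ≤ ((1/2) * ‖a‖ ^ 2 + ∫ t in (0:ℝ)..T, ⟪A (u t), u t⟫)
        * ((∫ t in (0:ℝ)..T, ⟪A (w t), w t⟫) + 2 * ‖b‖ ^ 2) := by
  have hint : ∀ {v z : ℝ → E}, ContinuousOn v (Icc (0:ℝ) T) → ContinuousOn z (Icc (0:ℝ) T) →
      IntervalIntegrable (fun t => ⟪A (v t), z t⟫) MeasureTheory.volume 0 T := by
    intro v z hv hz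
    apply ContinuousOn.intervalIntegrable
    rw [uIcc_of_le hT]
    exact (A.continuous.comp_continuousOn hv).inner hz
  have hquad : ∀ s : ℝ, 0 ≤ ((1/2) * ‖a‖ ^ 2 + ∫ t in (0:ℝ)..T, ⟪A (u t), u t⟫) * (s * s)
      + (-2 * ((∫ t in (0:ℝ)..T, ⟪A (u t), w t⟫) + ⟪a, b⟫)) * s
      + ((∫ t in (0:ℝ)..T, ⟪A (w t), w t⟫) + 2 * ‖b‖ ^ 2) := by
    intro s
    have hI : 0 ≤ ∫ t in (0:ℝ)..T, ⟪A (s • u t - w t), s • u t - w t⟫ :=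
      intervalIntegral.integral_nonneg hT fun t _ => hnonneg _
    have hexp : ∫ t in (0:ℝ)..T, ⟪A (s • u t - w t), s • u t - w t⟫
        = (s * s) * (∫ t in (0:ℝ)..T, ⟪A (u t), u t⟫)
          - (2 * s) * (∫ t in (0:ℝ)..T, ⟪A (u t), w t⟫)
          + ∫ t in (0:ℝ)..T, ⟪A (w t), w t⟫ := by
      rw [← intervalIntegral.integral_const_mul, ← intervalIntegral.integral_const_mul,
        ← intervalIntegral.integral_sub ((hint hu hu).const_mul _) ((hint hu hw).const_mul _),
        ← intervalIntegral.integral_add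
          (((hint hu hu).const_mul _).sub ((hint hu hw).const_mul _)) (hint hw hw)]
      congr 1
      ext t
      rw [map_sub, map_smul, inner_sub_left, inner_sub_right, inner_sub_right,
        real_inner_smul_left, real_inner_smul_left, real_inner_smul_right,
        real_inner_smul_right, hsym (w t) (u t), real_inner_comm (A (u t)) (w t)]
      ring
    have hab : 0 ≤ ‖s • a - (2:ℝ) • b‖ ^ 2 := sq_nonneg _
    rw [norm_sub_sq_real, norm_smul, norm_smul, real_inner_smul_left, real_inner_smul_right,
      mul_pow, mul_pow, Real.norm_eq_abs, Real.norm_eq_abs, sq_abs, sq_abs] at hab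
    rw [hexp] at hI
    nlinarith
  have hd := discrim_le_zero hquad
  rw [discrim] at hd
  nlinarith

/-- Solvability of the linear terminal value problem `φ' = A φ - g`, `φ T = b`. -/
theorem exists_hasDerivAt_linear [CompleteSpace E] (A : E →L[ℝ] E) {g : ℝ → E}
    (hg : Continuous g) (T : ℝ) (b : E) :
    ∃ φ : ℝ → E, φ T = b ∧ ∀ t, HasDerivAt φ (A (φ t) - g t) t := by
  have hexp : ∀ t : ℝ, HasDerivAt (fun s : ℝ => NormedSpace.exp (s • A))
      (A * NormedSpace.exp (t • A)) t := fun t => hasDerivAt_exp_smul_const' A t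
  have hcont : Continuous fun s : ℝ => NormedSpace.exp (s • A) :=
    continuous_iff_continuousAt.2 fun t => (hexp t).continuousAt
  have hinv : ∀ t : ℝ, NormedSpace.exp ((t - T) • A) * NormedSpace.exp ((T - t) • A) = 1 := by
    intro t
    let : NormedAlgebra ℚ (E →L[ℝ] E) := NormedAlgebra.restrictScalars ℚ ℝ _
    rw [← NormedSpace.exp_add_of_commute
      (((Commute.refl A).smul_left _).smul_right _), ← add_smul]
    simp
  have hh : Continuous fun s : ℝ => NormedSpace.exp ((T - s) • A) (g s) :=
    (hcont.comp (continuous_const.sub continuous_id)).clm_apply hg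
  refine ⟨fun t => NormedSpace.exp ((t - T) • A)
    (b - ∫ s in T..t, NormedSpace.exp ((T - s) • A) (g s)), by simp, fun t => ?_⟩
  have h1 : HasDerivAt (fun t : ℝ => NormedSpace.exp ((t - T) • A))
      (A * NormedSpace.exp ((t - T) • A)) t := by
    simpa [Function.comp_def] using (hexp (t - T)).scomp t ((hasDerivAt_id t).sub_const T)
  have h2 := (intervalIntegral.integral_hasDerivAt_right (hh.intervalIntegrable T t)
    (hh.stronglyMeasurableAtFilter _ _) hh.continuousAt).const_sub b
  convert h1.clm_apply h2 using 1
  have h3 := DFunLike.congr_fun (hinv t) (g t)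
  simp only [mul_apply_eq_comp, one_apply_eq_self] at h3
  rw [map_neg, h3, mul_apply_eq_comp, sub_eq_add_neg]

end EnergyNorm

open EnergyNorm

/-- Finite-dimensional analogue of the energy-norm characterization (2.22) of the
solution of the heat equation in terms of a dual norm of the data. -/
theorem stmt_4 (m : ℕ) (hm : 1 ≤ m)
    (A Ainv : EuclideanSpace ℝ (Fin m) →ₗ[ℝ] EuclideanSpace ℝ (Fin m))
    (hsym : ∀ x y, ⟪A x, y⟫ = ⟪x, A y⟫)
    (hpos : ∀ x, x ≠ 0 → 0 < ⟪A x, x⟫)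
    (hinv1 : ∀ x, Ainv (A x) = x) (hinv2 : ∀ x, A (Ainv x) = x)
    (T : ℝ) (hT : 0 < T)
    (f : ℝ → EuclideanSpace ℝ (Fin m)) (hf : ContinuousOn f (Set.Icc (0:ℝ) T))
    (u₀ : EuclideanSpace ℝ (Fin m))
    (u : ℝ → EuclideanSpace ℝ (Fin m))
    (hu : ∀ t ∈ Set.Icc (0:ℝ) T, HasDerivWithinAt u (f t - A (u t)) (Set.Icc (0:ℝ) T) t)
    (hu0 : u 0 = u₀) :
    IsGreatest
      { r : ℝ | ∃ φ φ' : ℝ → EuclideanSpace ℝ (Fin m),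
          (∀ t ∈ Set.Icc (0:ℝ) T, HasDerivWithinAt φ (φ' t) (Set.Icc (0:ℝ) T) t) ∧
          ContinuousOn φ' (Set.Icc (0:ℝ) T) ∧
          (∃ t ∈ Set.Icc (0:ℝ) T, φ t ≠ 0) ∧
          r = ((∫ t in (0:ℝ)..T, ⟪f t, φ t⟫) + ⟪u₀, φ 0⟫)
              / Real.sqrt ((∫ t in (0:ℝ)..T, (⟪Ainv (φ' t), φ' t⟫ + ⟪A (φ t), φ t⟫))
                  + ‖φ 0‖ ^ 2 + ‖φ T‖ ^ 2) }
      (Real.sqrt ((1/2) * ‖u T‖ ^ 2 + ∫ t in (0:ℝ)..T, ⟪A (u t), u t⟫)) := by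
  have hnonneg : ∀ x, 0 ≤ ⟪A x, x⟫ := fun x => by
    rcases eq_or_ne x 0 with rfl | hx
    · simp
    · exact (hpos x hx).le
  have hcu : ContinuousOn u (Icc (0:ℝ) T) := fun t ht => (hu t ht).continuousWithinAt
  obtain ⟨L, rfl⟩ : ∃ L : EuclideanSpace ℝ (Fin m) →L[ℝ] EuclideanSpace ℝ (Fin m),
      (L : EuclideanSpace ℝ (Fin m) →ₗ[ℝ] EuclideanSpace ℝ (Fin m)) = A :=
    ⟨A.toContinuousLinearMap, rfl⟩
  obtain ⟨K, rfl⟩ : ∃ K : EuclideanSpace ℝ (Fin m) →L[ℝ] EuclideanSpace ℝ (Fin m),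
      (K : EuclideanSpace ℝ (Fin m) →ₗ[ℝ] EuclideanSpace ℝ (Fin m)) = Ainv :=
    ⟨Ainv.toContinuousLinearMap, rfl⟩
  simp only [ContinuousLinearMap.coe_coe] at *
  subst hu0
  constructor
  · by_cases hzero : ∃ t ∈ Icc (0:ℝ) T, u t ≠ 0
    · have hg : Continuous fun t => L (IccExtend hT.le ((Icc (0:ℝ) T).domRestrict u) t) :=
        L.continuous.comp (continuousOn_iff_continuous_domRestrict.1 hcu).Icc_extend'
      obtain ⟨φ, hφT, hφ⟩ := exists_hasDerivAt_linear L hg T ((1/2 : ℝ) • u T)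
      have hφ' : ∀ t ∈ Icc (0:ℝ) T,
          HasDerivWithinAt φ (L (φ t) - L (u t)) (Icc (0:ℝ) T) t := fun t ht => by
        simpa [IccExtend_of_mem hT.le _ ht, domRestrict_apply] using (hφ t).hasDerivWithinAt
      have hcφ : ContinuousOn φ (Icc (0:ℝ) T) := fun t ht => (hφ' t ht).continuousWithinAt
      have hcφ' : ContinuousOn (fun t => L (φ t) - L (u t)) (Icc (0:ℝ) T) :=
        (L.continuous.comp_continuousOn hcφ).sub (L.continuous.comp_continuousOn hcu)
      refine ⟨φ, fun t => L (φ t) - L (u t), hφ', hcφ', ?_, ?_⟩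
      · by_contra! hφ0
        obtain ⟨t, ht, hut⟩ := hzero
        have hd : HasDerivWithinAt φ 0 (Icc (0:ℝ) T) t :=
          (hasDerivWithinAt_const t _ (0 : EuclideanSpace ℝ (Fin m))).congr hφ0 (hφ0 t ht)
        have heq := (uniqueDiffOn_Icc hT t ht).eq_deriv _ (hφ' t ht) hd
        rw [hφ0 t ht, map_zero, zero_sub, neg_eq_zero] at heq
        exact hut (by rw [← hinv1 (u t), heq, map_zero])
      · rw [integral_inner_source_add hT hsym hinv2 hf hu hφ' hcφ',
          integral_energy_add_norm_sq hT hsym hinv2 hφ' hcφ']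
        have hw : ∀ t, φ t - K (L (φ t) - L (u t)) = u t := fun t => by
          rw [map_sub, hinv1, hinv1, sub_sub_cancel]
        simp only [hw]
        rw [hφT, real_inner_smul_right, real_inner_self_eq_norm_sq, norm_smul, mul_pow,
          Real.norm_eq_abs, sq_abs,
          show 2 * ((1/2 : ℝ) ^ 2 * ‖u T‖ ^ 2) = 1/2 * ‖u T‖ ^ 2 by ring, Real.div_sqrt,
          add_comm]
    · push Not at hzero
      have hconst : ∀ t ∈ Icc (0:ℝ) T, HasDerivWithinAt
          (fun _ => EuclideanSpace.single (⟨0, hm⟩ : Fin m) (1:ℝ)) 0 (Icc (0:ℝ) T) t :=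
        fun t _ => hasDerivWithinAt_const t _ _
      refine ⟨_, fun _ => 0, hconst, continuousOn_const,
        ⟨0, left_mem_Icc.2 hT.le, by simp⟩, ?_⟩
      have hint : ∀ z : EuclideanSpace ℝ (Fin m) → EuclideanSpace ℝ (Fin m),
          ∫ t in (0:ℝ)..T, ⟪L (u t), z (u t)⟫ = 0 := fun z => by
        rw [intervalIntegral.integral_congr (g := fun _ => (0:ℝ)) fun t ht => ?_]
        · simp
        · rw [uIcc_of_le hT.le] at ht
          simp [hzero t ht]
      rw [integral_inner_source_add hT hsym hinv2 hf hu hconst continuousOn_const,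
        hint fun x => x, hint fun _ => _, hzero T (right_mem_Icc.2 hT.le)]
      simp
  · rintro r ⟨φ, φ', hφ, hφ', -, rfl⟩
    have hcφ : ContinuousOn φ (Icc (0:ℝ) T) := fun t ht => (hφ t ht).continuousWithinAt
    rw [integral_inner_source_add hT hsym hinv2 hf hu hφ hφ',
      integral_energy_add_norm_sq hT hsym hinv2 hφ hφ']
    have hE : 0 ≤ (1/2) * ‖u T‖ ^ 2 + ∫ t in (0:ℝ)..T, ⟪L (u t), u t⟫ :=
      add_nonneg (by positivity) (intervalIntegral.integral_nonneg hT.le fun t _ => hnonneg _)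
    refine div_le_of_le_mul₀ (Real.sqrt_nonneg _) (Real.sqrt_nonneg _) ?_
    rw [← Real.sqrt_mul hE]
    exact Real.le_sqrt_of_sq_le (sq_integral_inner_add_le hT.le hsym hnonneg hcu
      (hcφ.sub (K.continuous.comp_continuousOn hφ')) _ _)
end

section
/- Semidiscrete orthogonality of the errors (identity (1.4) of the paper, finite-dimensional analogue): the error to the piecewise constant reconstruction and the error to the piecewise affine reconstruction are orthogonal in the energy inner product, i.e. ½‖u(T) − u_N‖² + Σ_{n=1}^{N} ∫_{t_{n-1}}^{t_n} ⟨A(u(t) − u_n), u(t) − U_τ(t)⟩ dt = 0. -/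
open scoped RealInnerProductSpace

/-- On one implicit Euler step, the energy product of the error to the constant reconstruction
with the error to the affine reconstruction is the decrease of half the squared nodal error. -/
theorem integral_inner_implicitEuler_errors {E : Type*} [NormedAddCommGroup E]
    [InnerProductSpace ℝ E] (A : E →L[ℝ] E) {a b : ℝ} (hab : a < b) {v w g : E}
    (hstep : (b - a)⁻¹ • (w - v) + A w = g) {y : ℝ → E}
    (hy : ContinuousOn y (Set.Icc a b))
    (hode : ∀ s ∈ Set.Ioo a b, HasDerivAt y (g - A (y s)) s) :
    ∫ s in a..b, ⟪A (y s - w), y s - (((s - a) / (b - a)) • w + ((b - s) / (b - a)) • v)⟫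
      = (1/2) * ‖y a - v‖ ^ 2 - (1/2) * ‖y b - w‖ ^ 2 := by
  have hne : b - a ≠ 0 := (sub_pos.2 hab).ne'
  set e : ℝ → E := fun s => y s - (((s - a) / (b - a)) • w + ((b - s) / (b - a)) • v) with he
  have hec : ContinuousOn e (Set.Icc a b) := hy.sub (by fun_prop)
  have hed : ∀ s ∈ Set.Ioo a b, HasDerivAt e (-A (y s - w)) s := by
    intro s hs
    have h1 := (((hasDerivAt_id s).sub_const a).div_const (b - a)).smul_const w
    have h2 := (((hasDerivAt_id s).const_sub b).div_const (b - a)).smul_const v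
    refine ((hode s hs).sub (h1.add h2)).congr_deriv ?_
    rw [← hstep, map_sub]
    simp only [neg_div, one_div]
    module
  have hint : IntervalIntegrable (fun s => ⟪A (y s - w), e s⟫) MeasureTheory.volume a b := by
    apply ContinuousOn.intervalIntegrable
    rw [Set.uIcc_of_le hab.le]
    exact (A.continuous.comp_continuousOn (hy.sub continuousOn_const)).inner hec
  have hFd : ∀ s ∈ Set.Ioo a b,
      HasDerivAt (fun s => -(1/2) * ‖e s‖ ^ 2) ⟪A (y s - w), e s⟫ s := by
    intro s hs
    refine ((hed s hs).norm_sq.const_mul (-(1/2))).congr_deriv ?_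
    rw [inner_neg_right, real_inner_comm]
    ring
  rw [intervalIntegral.integral_eq_sub_of_hasDerivAt_of_le hab.le
    (continuousOn_const.mul (hec.norm.pow 2)) hFd hint]
  have hea : e a = y a - v := by simp [he, hne]
  have heb : e b = y b - w := by simp [he, hne]
  simp only [Pi.mul_apply, Pi.pow_apply, hea, heb]
  ring

/-- Semidiscrete orthogonality of the errors (identity (1.4)): the error to the
piecewise constant reconstruction and the error to the piecewise affine
reconstruction are orthogonal in the energy inner product. -/
theorem stmt_5 (m : ℕ) (hm : 1 ≤ m)
    (A : EuclideanSpace ℝ (Fin m) →ₗ[ℝ] EuclideanSpace ℝ (Fin m))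
    (hsym : ∀ x y, ⟪A x, y⟫ = ⟪x, A y⟫)
    (hpos : ∀ x, x ≠ 0 → 0 < ⟪A x, x⟫)
    (T : ℝ) (hT : 0 < T)
    (N : ℕ) (hN : 1 ≤ N)
    (t : ℕ → ℝ) (ht0 : t 0 = 0) (htN : t N = T)
    (hmono : ∀ n < N, t n < t (n + 1))
    (u : ℕ → EuclideanSpace ℝ (Fin m)) (f : ℕ → EuclideanSpace ℝ (Fin m))
    (hscheme : ∀ n < N,
      (t (n + 1) - t n)⁻¹ • (u (n + 1) - u n) + A (u (n + 1)) = f (n + 1))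
    (uex : ℝ → EuclideanSpace ℝ (Fin m))
    (huc : ContinuousOn uex (Set.Icc (0:ℝ) T))
    (hu0 : uex 0 = u 0)
    (hode : ∀ n < N, ∀ s ∈ Set.Ioo (t n) (t (n + 1)),
      HasDerivAt uex (f (n + 1) - A (uex s)) s) :
    (1/2) * ‖uex T - u N‖ ^ 2
      + ∑ n ∈ Finset.range N, ∫ s in (t n)..(t (n + 1)),
          ⟪A (uex s - u (n + 1)),
            uex s - (((s - t n) / (t (n + 1) - t n)) • u (n + 1)
              + ((t (n + 1) - s) / (t (n + 1) - t n)) • u n)⟫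
      = 0 := by
  have hle : ∀ i j, i ≤ j → j ≤ N → t i ≤ t j := by
    intro i j hij
    induction j, hij using Nat.le_induction with
    | base => exact fun _ => le_rfl
    | succ k _ ih => exact fun hk => (ih (by omega)).trans (hmono k hk).le
  have hstep : ∀ n ∈ Finset.range N, (∫ s in (t n)..(t (n + 1)),
      ⟪A (uex s - u (n + 1)),
        uex s - (((s - t n) / (t (n + 1) - t n)) • u (n + 1)
          + ((t (n + 1) - s) / (t (n + 1) - t n)) • u n)⟫)
      = (1/2) * ‖uex (t n) - u n‖ ^ 2 - (1/2) * ‖uex (t (n + 1)) - u (n + 1)‖ ^ 2 := by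
    intro n hn
    have hn : n < N := Finset.mem_range.1 hn
    refine integral_inner_implicitEuler_errors (LinearMap.toContinuousLinearMap A) (hmono n hn)
      (hscheme n hn) (huc.mono (Set.Icc_subset_Icc ?_ ?_)) (hode n hn)
    · exact ht0 ▸ hle 0 n n.zero_le hn.le
    · exact htN ▸ hle (n + 1) N hn le_rfl
  rw [Finset.sum_congr rfl hstep,
    Finset.sum_range_sub' (fun n => (1/2) * ‖uex (t n) - u n‖ ^ 2), ht0, htN, hu0]
  simp
end

section
/- Pythagoras identity for the semidiscrete errors (identity (1.5) of the paper, finite-dimensional analogue): ‖u − u_τ‖_E² + ‖u − U_τ‖_E² = ‖u_τ − U_τ‖_E², that is, [½‖u(T) − u_N‖² + Σ_{n=1}^{N} ∫_{t_{n-1}}^{t_n} ⟨A(u(t) − u_n), u(t) − u_n⟩ dt] + [½‖u(T) − u_N‖² + Σ_{n=1}^{N} ∫_{t_{n-1}}^{t_n} ⟨A(u(t) − U_τ(t)), u(t) − U_τ(t)⟩ dt] = Σ_{n=1}^{N} ∫_{t_{n-1}}^{t_n} ⟨A(u_n − U_τ(t)), u_n − U_τ(t)⟩ dt. -/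
open scoped RealInnerProductSpace

section EulerStep

variable {E : Type*} [NormedAddCommGroup E] [InnerProductSpace ℝ E]

/-- The affine interpolant of the values `p` at `a` and `q` at `b`. -/
noncomputable def affineInterp (a b : ℝ) (p q : E) (s : ℝ) : E :=
  ((s - a) / (b - a)) • q + ((b - s) / (b - a)) • p

lemma hasDerivAt_affineInterp (a b : ℝ) (p q : E) (s : ℝ) :
    HasDerivAt (affineInterp a b p q) ((b - a)⁻¹ • (q - p)) s := by
  have h₁ := ((((hasDerivAt_id s).sub_const a).div_const (b - a)).smul_const q).add
    ((((hasDerivAt_id s).const_sub b).div_const (b - a)).smul_const p)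
  refine h₁.congr_deriv ?_
  rw [neg_div, one_div, neg_smul, smul_sub, ← sub_eq_add_neg]

lemma continuous_affineInterp (a b : ℝ) (p q : E) : Continuous (affineInterp a b p q) :=
  continuous_iff_continuousAt.2 fun s => (hasDerivAt_affineInterp a b p q s).continuousAt

lemma affineInterp_left {a b : ℝ} (hab : a < b) (p q : E) : affineInterp a b p q a = p := by
  simp [affineInterp, div_self (sub_pos.2 hab).ne']

lemma affineInterp_right {a b : ℝ} (hab : a < b) (p q : E) : affineInterp a b p q b = q := by
  simp [affineInterp, div_self (sub_pos.2 hab).ne']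

/-- Polarization for a symmetric map. -/
lemma inner_map_sub_polarization {A : E →ₗ[ℝ] E} (hsym : ∀ x y, ⟪A x, y⟫ = ⟪x, A y⟫) (x v w : E) :
    ⟪A (x - v), x - v⟫ + ⟪A (x - w), x - w⟫ - ⟪A (v - w), v - w⟫ = 2 * ⟪x - w, A (x - v)⟫ := by
  obtain ⟨a, ha⟩ : ∃ a, x - v = a := ⟨_, rfl⟩
  obtain ⟨b, hb⟩ : ∃ b, x - w = b := ⟨_, rfl⟩
  have hvw : v - w = b - a := by rw [← ha, ← hb]; abel
  rw [hvw, ha, hb, map_sub, inner_sub_left, inner_sub_right, inner_sub_right, hsym b a,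
    real_inner_comm b (A a)]
  ring

/-- The energy balance over a single step of the implicit Euler scheme. -/
lemma euler_step_pythagoras [FiniteDimensional ℝ E] {A : E →ₗ[ℝ] E}
    (hsym : ∀ x y, ⟪A x, y⟫ = ⟪x, A y⟫) {a b : ℝ} (hab : a < b) {p q g : E}
    (hscheme : (b - a)⁻¹ • (q - p) + A q = g) {x : ℝ → E} (hx : ContinuousOn x (Set.Icc a b))
    (hode : ∀ s ∈ Set.Ioo a b, HasDerivAt x (g - A (x s)) s) :
    (∫ s in a..b, ⟪A (x s - q), x s - q⟫)
        + (∫ s in a..b, ⟪A (x s - affineInterp a b p q s), x s - affineInterp a b p q s⟫)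
      = (∫ s in a..b, ⟪A (q - affineInterp a b p q s), q - affineInterp a b p q s⟫)
        - (‖x b - q‖ ^ 2 - ‖x a - p‖ ^ 2) := by
  have hA : Continuous A := A.continuous_of_finiteDimensional
  have hw := (continuous_affineInterp a b p q).continuousOn (s := Set.Icc a b)
  have hq : ContinuousOn (fun _ => q) (Set.Icc a b) := continuousOn_const
  have integrable {y z : ℝ → E} (hy : ContinuousOn y (Set.Icc a b))
      (hz : ContinuousOn z (Set.Icc a b)) :
      IntervalIntegrable (fun s => ⟪y s, z s⟫) MeasureTheory.volume a b :=
    (hy.inner hz).intervalIntegrable_of_Icc hab.le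
  have h₁ := integrable (hA.comp_continuousOn (hx.sub hq))
    (hx.sub hq)
  have h₂ := integrable (hA.comp_continuousOn (hx.sub hw)) (hx.sub hw)
  have h₃ := integrable (hA.comp_continuousOn (hq.sub hw)) (hq.sub hw)
  have h₄ := integrable (hx.sub hw) (hA.comp_continuousOn (hx.sub hq))
  simp only [Pi.sub_apply, Function.comp_apply] at h₁ h₂ h₃ h₄
  have ftc := intervalIntegral.integral_eq_sub_of_hasDerivAt_of_le hab.le
    (f := fun s => ‖x s - affineInterp a b p q s‖ ^ 2)
    (f' := fun s => -2 * ⟪x s - affineInterp a b p q s, A (x s - q)⟫)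
    ((hx.sub hw).norm.pow 2)
    (fun s hs => by
      refine ((hode s hs).sub (hasDerivAt_affineInterp a b p q s)).norm_sq.congr_deriv ?_
      have : g - A (x s) - (b - a)⁻¹ • (q - p) = -A (x s - q) := by
        rw [← hscheme, map_sub]; abel
      rw [this, inner_neg_right, Pi.sub_apply]; ring)
    (h₄.const_mul _)
  rw [affineInterp_left hab, affineInterp_right hab] at ftc
  rw [← ftc, ← intervalIntegral.integral_add h₁ h₂,
    ← intervalIntegral.integral_sub h₃ (h₄.const_mul _)]
  refine intervalIntegral.integral_congr fun s _ => ?_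
  have := inner_map_sub_polarization hsym (x s) q (affineInterp a b p q s)
  linarith

end EulerStep

/-- Pythagoras identity for the semidiscrete errors (identity (1.5)):
`‖u − u_τ‖_E² + ‖u − U_τ‖_E² = ‖u_τ − U_τ‖_E²`. -/
theorem stmt_6 (m : ℕ) (hm : 1 ≤ m)
    (A : EuclideanSpace ℝ (Fin m) →ₗ[ℝ] EuclideanSpace ℝ (Fin m))
    (hsym : ∀ x y, ⟪A x, y⟫ = ⟪x, A y⟫)
    (hpos : ∀ x, x ≠ 0 → 0 < ⟪A x, x⟫)
    (T : ℝ) (hT : 0 < T)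
    (N : ℕ) (hN : 1 ≤ N)
    (t : ℕ → ℝ) (ht0 : t 0 = 0) (htN : t N = T)
    (hmono : ∀ n < N, t n < t (n + 1))
    (u : ℕ → EuclideanSpace ℝ (Fin m)) (f : ℕ → EuclideanSpace ℝ (Fin m))
    (hscheme : ∀ n < N,
      (t (n + 1) - t n)⁻¹ • (u (n + 1) - u n) + A (u (n + 1)) = f (n + 1))
    (uex : ℝ → EuclideanSpace ℝ (Fin m))
    (huc : ContinuousOn uex (Set.Icc (0:ℝ) T))
    (hu0 : uex 0 = u 0)
    (hode : ∀ n < N, ∀ s ∈ Set.Ioo (t n) (t (n + 1)),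
      HasDerivAt uex (f (n + 1) - A (uex s)) s) :
    ((1/2) * ‖uex T - u N‖ ^ 2
        + ∑ n ∈ Finset.range N, ∫ s in (t n)..(t (n + 1)),
            ⟪A (uex s - u (n + 1)), uex s - u (n + 1)⟫)
      + ((1/2) * ‖uex T - u N‖ ^ 2
        + ∑ n ∈ Finset.range N, ∫ s in (t n)..(t (n + 1)),
            ⟪A (uex s - (((s - t n) / (t (n + 1) - t n)) • u (n + 1)
                + ((t (n + 1) - s) / (t (n + 1) - t n)) • u n)),
              uex s - (((s - t n) / (t (n + 1) - t n)) • u (n + 1)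
                + ((t (n + 1) - s) / (t (n + 1) - t n)) • u n)⟫)
      = ∑ n ∈ Finset.range N, ∫ s in (t n)..(t (n + 1)),
          ⟪A (u (n + 1) - (((s - t n) / (t (n + 1) - t n)) • u (n + 1)
              + ((t (n + 1) - s) / (t (n + 1) - t n)) • u n)),
            u (n + 1) - (((s - t n) / (t (n + 1) - t n)) • u (n + 1)
              + ((t (n + 1) - s) / (t (n + 1) - t n)) • u n)⟫ := by
  have hmono' : MonotoneOn t (Set.Iic N) :=
    monotoneOn_of_le_add_one Set.ordConnected_Iic fun n _ _ hn =>
      (hmono n (Nat.lt_of_succ_le hn)).le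
  have hsub (n : ℕ) (hn : n < N) : Set.Icc (t n) (t (n + 1)) ⊆ Set.Icc 0 T := by
    refine Set.Icc_subset_Icc ?_ ?_
    · exact ht0 ▸ hmono' N.zero_le hn.le n.zero_le
    · exact htN ▸ hmono' (Nat.succ_le_of_lt hn) (Set.mem_Iic.2 le_rfl) (Nat.succ_le_of_lt hn)
  have hstep := Finset.sum_congr rfl fun n hn =>
    have hn := Finset.mem_range.1 hn
    euler_step_pythagoras hsym (hmono n hn) (hscheme n hn) (huc.mono (hsub n hn)) (hode n hn)
  rw [Finset.sum_add_distrib, Finset.sum_sub_distrib,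
    Finset.sum_range_sub (fun n => ‖uex (t n) - u n‖ ^ 2), htN, ht0, hu0, sub_self, norm_zero]
    at hstep
  simp only [affineInterp] at hstep
  linarith
end

section
/- Hypercircle identity (identity (1.7) of the paper, finite-dimensional analogue): the exact solution u lies on a hypercircle of radius ½‖u_τ − U_τ‖_E centred at the average of the two reconstructions, i.e. ‖u − ½(u_τ + U_τ)‖_E = ½ ‖u_τ − U_τ‖_E, where ‖u − ½(u_τ + U_τ)‖_E² = ½‖u(T) − u_N‖² + Σ_{n=1}^{N} ∫_{t_{n-1}}^{t_n} ⟨A(u(t) − ½(u_n + U_τ(t))), u(t) − ½(u_n + U_τ(t))⟩ dt and ‖u_τ − U_τ‖_E² = Σ_{n=1}^{N} ∫_{t_{n-1}}^{t_n} ⟨A(u_n − U_τ(t)), u_n − U_τ(t)⟩ dt. -/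
open scoped RealInnerProductSpace

/-- Energy balance of the implicit Euler method on a single time step `[a, b]`, where `v` and `w`
are the old and the new iterate and `x` is the exact flow of `x' + A x = g`. -/
theorem integral_hypercircle_step {E : Type*} [NormedAddCommGroup E] [InnerProductSpace ℝ E]
    (A : E →ₗ[ℝ] E) (hA : Continuous A) (hsym : ∀ x y, ⟪A x, y⟫ = ⟪x, A y⟫) {a b : ℝ} (hab : a < b) {v w g : E}
    (hstep : (b - a)⁻¹ • (w - v) + A w = g) {x : ℝ → E} (hx : ContinuousOn x (Set.Icc a b))
    (hode : ∀ s ∈ Set.Ioo a b, HasDerivAt x (g - A (x s)) s) :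
    ∫ s in a..b,
        ⟪A (x s - (1 / 2 : ℝ) • (w + (((s - a) / (b - a)) • w + ((b - s) / (b - a)) • v))),
          x s - (1 / 2 : ℝ) • (w + (((s - a) / (b - a)) • w + ((b - s) / (b - a)) • v))⟫
      = (1 / 4) * (∫ s in a..b,
          ⟪A (w - (((s - a) / (b - a)) • w + ((b - s) / (b - a)) • v)),
            w - (((s - a) / (b - a)) • w + ((b - s) / (b - a)) • v)⟫)
        - (1 / 2) * (‖x b - w‖ ^ 2 - ‖x a - v‖ ^ 2) := by
  have hba : b - a ≠ 0 := (sub_pos.2 hab).ne'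
  set U : ℝ → E := fun s => ((s - a) / (b - a)) • w + ((b - s) / (b - a)) • v with hU
  have hUcont : Continuous U := by fun_prop
  have hUa : U a = v := by simp [hU, div_self hba]
  have hUb : U b = w := by simp [hU, div_self hba]
  have hUderiv (s : ℝ) : HasDerivAt U (g - A w) s := by
    have h₁ : HasDerivAt (fun s : ℝ => (s - a) / (b - a)) (1 / (b - a)) s :=
      ((hasDerivAt_id s).sub_const a).div_const _
    have h₂ : HasDerivAt (fun s : ℝ => (b - s) / (b - a)) (-1 / (b - a)) s :=
      ((hasDerivAt_id s).const_sub b).div_const _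
    refine ((h₁.smul_const w).add (h₂.smul_const v)).congr_deriv ?_
    rw [← hstep]
    module
  have hI₁ : IntervalIntegrable (fun s => ⟪A (w - U s), w - U s⟫) MeasureTheory.volume a b :=
    Continuous.intervalIntegrable (by fun_prop) a b
  have hI₂ : IntervalIntegrable (fun s => ⟪A (x s - w), x s - U s⟫) MeasureTheory.volume a b := by
    apply ContinuousOn.intervalIntegrable
    rw [Set.uIcc_of_le hab.le]
    fun_prop
  have hFTC : ∫ s in a..b, -2 * ⟪A (x s - w), x s - U s⟫ = ‖x b - w‖ ^ 2 - ‖x a - v‖ ^ 2 := by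
    have h := intervalIntegral.integral_eq_sub_of_hasDerivAt_of_le
      (f := fun s => ‖x s - U s‖ ^ 2) (f' := fun s => -2 * ⟪A (x s - w), x s - U s⟫) hab.le
      (by fun_prop) (fun s hs => ?_) (hI₂.const_mul _)
    · simpa only [hUa, hUb] using h
    · refine ((hode s hs).sub (hUderiv s)).norm_sq.congr_deriv ?_
      have : g - A (x s) - (g - A w) = -A (x s - w) := by rw [map_sub]; abel
      rw [this, inner_neg_right, real_inner_comm]
      simp
  rw [intervalIntegral.integral_const_mul] at hFTC
  have hpoint (s : ℝ) :
      ⟪A (x s - (1 / 2 : ℝ) • (w + U s)), x s - (1 / 2 : ℝ) • (w + U s)⟫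
        = (1 / 4) * ⟪A (w - U s), w - U s⟫ + ⟪A (x s - w), x s - U s⟫ := by
    have h₁ : x s - (1 / 2 : ℝ) • (w + U s) = (1 / 2 : ℝ) • ((x s - w) + (x s - U s)) := by
      module
    have h₂ : w - U s = (x s - U s) - (x s - w) := by abel
    have h₃ : ⟪A (x s - U s), x s - w⟫ = ⟪A (x s - w), x s - U s⟫ := by
      rw [hsym, real_inner_comm]
    rw [h₁, h₂]
    generalize x s - w = p at *
    generalize x s - U s = q at *
    simp only [map_smul, map_add, map_sub, inner_smul_left, inner_smul_right, inner_add_left,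
      inner_add_right, inner_sub_left, inner_sub_right, h₃, conj_trivial]
    ring
  change ∫ s in a..b, ⟪A (x s - (1 / 2 : ℝ) • (w + U s)), x s - (1 / 2 : ℝ) • (w + U s)⟫
    = (1 / 4) * (∫ s in a..b, ⟪A (w - U s), w - U s⟫) - (1 / 2) * (‖x b - w‖ ^ 2 - ‖x a - v‖ ^ 2)
  simp only [hpoint]
  rw [intervalIntegral.integral_add (hI₁.const_mul _) hI₂, intervalIntegral.integral_const_mul]
  linarith

/-- Hypercircle identity (identity (1.7)): the exact solution lies on a hypercircle of
radius `½‖u_τ − U_τ‖_E` centred at the average of the two reconstructions. -/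
theorem stmt_8 (m : ℕ) (hm : 1 ≤ m)
    (A : EuclideanSpace ℝ (Fin m) →ₗ[ℝ] EuclideanSpace ℝ (Fin m))
    (hsym : ∀ x y, ⟪A x, y⟫ = ⟪x, A y⟫)
    (hpos : ∀ x, x ≠ 0 → 0 < ⟪A x, x⟫)
    (T : ℝ) (hT : 0 < T)
    (N : ℕ) (hN : 1 ≤ N)
    (t : ℕ → ℝ) (ht0 : t 0 = 0) (htN : t N = T)
    (hmono : ∀ n < N, t n < t (n + 1))
    (u : ℕ → EuclideanSpace ℝ (Fin m)) (f : ℕ → EuclideanSpace ℝ (Fin m))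
    (hscheme : ∀ n < N,
      (t (n + 1) - t n)⁻¹ • (u (n + 1) - u n) + A (u (n + 1)) = f (n + 1))
    (uex : ℝ → EuclideanSpace ℝ (Fin m))
    (huc : ContinuousOn uex (Set.Icc (0:ℝ) T))
    (hu0 : uex 0 = u 0)
    (hode : ∀ n < N, ∀ s ∈ Set.Ioo (t n) (t (n + 1)),
      HasDerivAt uex (f (n + 1) - A (uex s)) s) :
    Real.sqrt ((1/2) * ‖uex T - u N‖ ^ 2
        + ∑ n ∈ Finset.range N, ∫ s in (t n)..(t (n + 1)),
            ⟪A (uex s - (1/2 : ℝ) • (u (n + 1)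
                + (((s - t n) / (t (n + 1) - t n)) • u (n + 1)
                  + ((t (n + 1) - s) / (t (n + 1) - t n)) • u n))),
              uex s - (1/2 : ℝ) • (u (n + 1)
                + (((s - t n) / (t (n + 1) - t n)) • u (n + 1)
                  + ((t (n + 1) - s) / (t (n + 1) - t n)) • u n))⟫)
      = (1/2) * Real.sqrt (∑ n ∈ Finset.range N, ∫ s in (t n)..(t (n + 1)),
          ⟪A (u (n + 1) - (((s - t n) / (t (n + 1) - t n)) • u (n + 1)
              + ((t (n + 1) - s) / (t (n + 1) - t n)) • u n)),
            u (n + 1) - (((s - t n) / (t (n + 1) - t n)) • u (n + 1)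
              + ((t (n + 1) - s) / (t (n + 1) - t n)) • u n)⟫) := by
  have hmonoOn : MonotoneOn t (Set.Iic N) := by
    intro i _ j hj hij
    induction j, hij using Nat.le_induction with
    | base => exact le_rfl
    | succ k hik ih =>
      exact (ih (Nat.le_of_succ_le hj)).trans (hmono k hj).le
  have hsub (n : ℕ) (hn : n < N) : Set.Icc (t n) (t (n + 1)) ⊆ Set.Icc 0 T := by
    rw [← ht0, ← htN]
    exact Set.Icc_subset_Icc (hmonoOn (Nat.zero_le N) hn.le (Nat.zero_le n))
      (hmonoOn (Nat.succ_le_of_lt hn) (Set.mem_Iic.2 le_rfl) hn)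
  rw [Finset.sum_congr rfl fun n hn => integral_hypercircle_step
    A A.continuous_of_finiteDimensional hsym (hmono n (Finset.mem_range.1 hn))
    (hscheme n (Finset.mem_range.1 hn)) (huc.mono (hsub n (Finset.mem_range.1 hn)))
    (hode n (Finset.mem_range.1 hn))]
  rw [Finset.sum_sub_distrib, ← Finset.mul_sum, ← Finset.mul_sum,
    Finset.sum_range_sub (fun n => ‖uex (t n) - u n‖ ^ 2), ht0, htN, hu0, sub_self, norm_zero]
  have h_half : (1 / 2 : ℝ) = Real.sqrt (1 / 4) := by
    rw [show (1 / 4 : ℝ) = (1 / 2) ^ 2 by norm_num, Real.sqrt_sq (by norm_num)]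
  conv_rhs => rw [h_half, ← Real.sqrt_mul (by norm_num)]
  congr 1
  ring
end

section
/- Finite-dimensional analogue of the identity for the difference between reconstructions (Lemma 4.1 of the paper): for every continuously differentiable φ : [0,T] → ℝ^m, ½ Σ_{n=1}^{N} ∫_{t_{n-1}}^{t_n} [⟨φ'(t), w_n − W_τ(t)⟩ + ⟨A(w_n − W_τ(t)), φ(t)⟩] dt = [⟨u(T) − w_N, φ(T)⟩ + Σ_{n=1}^{N} ∫_{t_{n-1}}^{t_n} (−⟨φ'(t), u(t) − w̄(t)⟩ + ⟨Aφ(t), u(t) − w̄(t)⟩) dt] − Σ_{n=1}^{N} ∫_{t_{n-1}}^{t_n} ⟨f(t) − f_n, φ(t)⟩ dt − ⟨u_0 − w_0, φ(0)⟩. -/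
open scoped RealInnerProductSpace

/-- Integral identity on a single time step `[a, b]` for the error `u - W`, where `W` is the affine
interpolant of `d` at `a` and `c` at `b`, tested against a `C¹` function `φ`. -/
theorem integral_interpolation_gap_eq {E : Type*} [NormedAddCommGroup E] [InnerProductSpace ℝ E]
    (A : E →L[ℝ] E) (hsym : ∀ x y, ⟪A x, y⟫ = ⟪x, A y⟫) {a b : ℝ} (hab : a < b) (c d g : E)
    (hg : (b - a)⁻¹ • (c - d) + A c = g) {f u φ φ' : ℝ → E}
    (hf : ContinuousOn f (Set.Icc a b))
    (hu : ∀ s ∈ Set.Icc a b, HasDerivWithinAt u (f s - A (u s)) (Set.Icc a b) s)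
    (hφ : ∀ s ∈ Set.Icc a b, HasDerivWithinAt φ (φ' s) (Set.Icc a b) s)
    (hφ' : ContinuousOn φ' (Set.Icc a b)) :
    (1/2) * ∫ s in a..b,
        (⟪φ' s, c - (((s - a) / (b - a)) • c + ((b - s) / (b - a)) • d)⟫
          + ⟪A (c - (((s - a) / (b - a)) • c + ((b - s) / (b - a)) • d)), φ s⟫)
      = (⟪u b - c, φ b⟫ - ⟪u a - d, φ a⟫)
        + (∫ s in a..b,
            (-⟪φ' s, u s - (1/2 : ℝ) • (c
                + (((s - a) / (b - a)) • c + ((b - s) / (b - a)) • d))⟫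
              + ⟪A (φ s), u s - (1/2 : ℝ) • (c
                + (((s - a) / (b - a)) • c + ((b - s) / (b - a)) • d))⟫))
        - ∫ s in a..b, ⟪f s - g, φ s⟫ := by
  have hba : b - a ≠ 0 := sub_ne_zero.mpr hab.ne'
  set W : ℝ → E := fun s => ((s - a) / (b - a)) • c + ((b - s) / (b - a)) • d with hW
  have hWderiv : ∀ s, HasDerivAt W (g - A c) s := by
    intro s
    have h1 : HasDerivAt (fun s : ℝ => (s - a) / (b - a)) (1 / (b - a)) s :=
      ((hasDerivAt_id s).sub_const a).div_const _
    have h2 : HasDerivAt (fun s : ℝ => (b - s) / (b - a)) (-1 / (b - a)) s :=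
      ((hasDerivAt_id s).const_sub b).div_const _
    refine ((h1.smul_const c).add (h2.smul_const d)).congr_deriv ?_
    rw [← hg]
    module
  have hWcont : Continuous W := continuous_iff_continuousAt.mpr fun s => (hWderiv s).continuousAt
  have hWa : W a = d := by simp [hW, div_self hba]
  have hWb : W b = c := by simp [hW, div_self hba]
  have hucont : ContinuousOn u (Set.Icc a b) := fun s hs => (hu s hs).continuousWithinAt
  have hφcont : ContinuousOn φ (Set.Icc a b) := fun s hs => (hφ s hs).continuousWithinAt
  have hWon : ContinuousOn W (Set.Icc a b) := hWcont.continuousOn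
  have hgap : IntervalIntegrable (fun s => -⟪φ' s, u s - (1/2 : ℝ) • (c + W s)⟫
      + ⟪A (φ s), u s - (1/2 : ℝ) • (c + W s)⟫) MeasureTheory.volume a b :=
    ContinuousOn.intervalIntegrable_of_Icc hab.le (by fun_prop)
  have hdata : IntervalIntegrable (fun s => ⟪f s - g, φ s⟫) MeasureTheory.volume a b :=
    ContinuousOn.intervalIntegrable_of_Icc hab.le (by fun_prop)
  have hderivInt : IntervalIntegrable
      (fun s => ⟪u s - W s, φ' s⟫ + ⟪f s - A (u s) - (g - A c), φ s⟫)
      MeasureTheory.volume a b :=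
    ContinuousOn.intervalIntegrable_of_Icc hab.le (by fun_prop)
  have hFTC : ∫ s in a..b, (⟪u s - W s, φ' s⟫ + ⟪f s - A (u s) - (g - A c), φ s⟫)
      = ⟪u b - c, φ b⟫ - ⟪u a - d, φ a⟫ := by
    rw [intervalIntegral.integral_eq_sub_of_hasDerivAt_of_le
      (f := fun s => ⟪u s - W s, φ s⟫) hab.le (by fun_prop) ?_ hderivInt, hWa, hWb]
    intro s hs
    have hmem := Set.Ioo_subset_Icc_self hs
    have hnhds := Icc_mem_nhds hs.1 hs.2
    exact (((hu s hmem).hasDerivAt hnhds).sub (hWderiv s)).inner ℝ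
      ((hφ s hmem).hasDerivAt hnhds)
  rw [← hFTC, ← intervalIntegral.integral_add hderivInt hgap,
    ← intervalIntegral.integral_sub (hderivInt.add hgap) hdata,
    ← intervalIntegral.integral_const_mul]
  refine intervalIntegral.integral_congr fun s _ => ?_
  change 1 / 2 * (⟪φ' s, c - W s⟫ + ⟪A (c - W s), φ s⟫)
    = ⟪u s - W s, φ' s⟫ + ⟪f s - A (u s) - (g - A c), φ s⟫
      + (-⟪φ' s, u s - (1/2 : ℝ) • (c + W s)⟫ + ⟪A (φ s), u s - (1/2 : ℝ) • (c + W s)⟫)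
      - ⟪f s - g, φ s⟫
  rw [hsym (φ s)]
  simp only [map_sub, map_add, map_smul, inner_sub_left, inner_sub_right, inner_add_right,
    real_inner_smul_right]
  rw [real_inner_comm (u s) (φ' s), real_inner_comm (W s) (φ' s),
    real_inner_comm (A (u s)) (φ s), real_inner_comm (A c) (φ s), real_inner_comm (A (W s)) (φ s)]
  ring

/-- Finite-dimensional analogue of Lemma 4.1 (identity for the difference between the
two reconstructions, tested against an arbitrary `C¹` test function `φ`). -/
theorem stmt_10 (m : ℕ) (hm : 1 ≤ m)
    (A : EuclideanSpace ℝ (Fin m) →ₗ[ℝ] EuclideanSpace ℝ (Fin m))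
    (hsym : ∀ x y, ⟪A x, y⟫ = ⟪x, A y⟫)
    (hpos : ∀ x, x ≠ 0 → 0 < ⟪A x, x⟫)
    (T : ℝ) (hT : 0 < T)
    (N : ℕ) (hN : 1 ≤ N)
    (t : ℕ → ℝ) (ht0 : t 0 = 0) (htN : t N = T)
    (hmono : ∀ n < N, t n < t (n + 1))
    (w : ℕ → EuclideanSpace ℝ (Fin m)) (fd : ℕ → EuclideanSpace ℝ (Fin m))
    (hscheme : ∀ n < N,
      (t (n + 1) - t n)⁻¹ • (w (n + 1) - w n) + A (w (n + 1)) = fd (n + 1))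
    (f : ℝ → EuclideanSpace ℝ (Fin m)) (hf : ContinuousOn f (Set.Icc (0:ℝ) T))
    (u₀ : EuclideanSpace ℝ (Fin m))
    (uex : ℝ → EuclideanSpace ℝ (Fin m))
    (hu : ∀ s ∈ Set.Icc (0:ℝ) T,
      HasDerivWithinAt uex (f s - A (uex s)) (Set.Icc (0:ℝ) T) s)
    (hu0 : uex 0 = u₀)
    (φ φ' : ℝ → EuclideanSpace ℝ (Fin m))
    (hφ : ∀ s ∈ Set.Icc (0:ℝ) T, HasDerivWithinAt φ (φ' s) (Set.Icc (0:ℝ) T) s)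
    (hφ' : ContinuousOn φ' (Set.Icc (0:ℝ) T)) :
    (1/2) * ∑ n ∈ Finset.range N, ∫ s in (t n)..(t (n + 1)),
        (⟪φ' s, w (n + 1) - (((s - t n) / (t (n + 1) - t n)) • w (n + 1)
            + ((t (n + 1) - s) / (t (n + 1) - t n)) • w n)⟫
          + ⟪A (w (n + 1) - (((s - t n) / (t (n + 1) - t n)) • w (n + 1)
              + ((t (n + 1) - s) / (t (n + 1) - t n)) • w n)), φ s⟫)
      = (⟪uex T - w N, φ T⟫
          + ∑ n ∈ Finset.range N, ∫ s in (t n)..(t (n + 1)),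
              (-⟪φ' s, uex s - (1/2 : ℝ) • (w (n + 1)
                  + (((s - t n) / (t (n + 1) - t n)) • w (n + 1)
                    + ((t (n + 1) - s) / (t (n + 1) - t n)) • w n))⟫
                + ⟪A (φ s), uex s - (1/2 : ℝ) • (w (n + 1)
                    + (((s - t n) / (t (n + 1) - t n)) • w (n + 1)
                      + ((t (n + 1) - s) / (t (n + 1) - t n)) • w n))⟫))
        - (∑ n ∈ Finset.range N, ∫ s in (t n)..(t (n + 1)),
            ⟪f s - fd (n + 1), φ s⟫)
        - ⟪u₀ - w 0, φ 0⟫ := by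
  have hmonoOn : MonotoneOn t (Set.Icc 0 N) :=
    monotoneOn_of_le_succ Set.ordConnected_Icc fun n _ _ hn => (hmono n hn.2).le
  have hsub : ∀ n < N, Set.Icc (t n) (t (n + 1)) ⊆ Set.Icc 0 T := fun n hn =>
    Set.Icc_subset_Icc
      (ht0 ▸ hmonoOn ⟨le_rfl, N.zero_le⟩ ⟨n.zero_le, hn.le⟩ n.zero_le)
      (htN ▸ hmonoOn ⟨(n + 1).zero_le, hn⟩ ⟨N.zero_le, le_rfl⟩ hn)
  have hstep := fun n (hn : n < N) =>
    integral_interpolation_gap_eq A.toContinuousLinearMap hsym (hmono n hn)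
      (w (n + 1)) (w n) (fd (n + 1)) (hscheme n hn) (hf.mono (hsub n hn))
      (fun s hs => (hu s (hsub n hn hs)).mono (hsub n hn))
      (fun s hs => (hφ s (hsub n hn hs)).mono (hsub n hn)) (hφ'.mono (hsub n hn))
  simp only [LinearMap.coe_toContinuousLinearMap'] at hstep
  have htel := Finset.sum_range_sub (fun n => ⟪uex (t n) - w n, φ (t n)⟫) N
  rw [Finset.mul_sum, Finset.sum_congr rfl fun n hn => hstep n (Finset.mem_range.mp hn),
    Finset.sum_sub_distrib, Finset.sum_add_distrib, htel, htN, ht0, hu0]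
  ring
end

section
/- First limit of the appendix example (inefficiency of the temporal jump estimator with respect to the error of the affine reconstruction as λ → 0⁺): with e_jump(λ) := (λ ∫₀¹ ((1−t)/(1+λ))² dt)^{1/2} and e_aff(λ) := (½((1−e^{−λ})/λ − 1/(1+λ))² + λ ∫₀¹ ((1−e^{−λt})/λ − t/(1+λ))² dt)^{1/2}, one has e_aff(λ) > 0 for every λ > 0, and the ratio e_jump(λ)/e_aff(λ) tends to +∞ as λ → 0⁺ (i.e. along the filter of positive reals approaching 0). -/
open Filter

/-- The error of the implicit Euler affine reconstruction is nonnegative on `[0, 1]`. -/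
theorem affine_error_nonneg {l s : ℝ} (hl : 0 < l) (hs₀ : 0 ≤ s) (hs₁ : s ≤ 1) :
    0 ≤ (1 - Real.exp (-l * s)) / l - s / (1 + l) := by
  have hls : 0 ≤ l * s := by positivity
  have h_exp : Real.exp (-l * s) ≤ 1 / (1 + l * s) := by
    rw [neg_mul, Real.exp_neg, ← one_div]
    exact one_div_le_one_div_of_le (by positivity) (by linarith [Real.add_one_le_exp (l * s)])
  have h_frac : s / (1 + l) ≤ s / (1 + l * s) :=
    div_le_div_of_nonneg_left hs₀ (by positivity) (by nlinarith)
  have h_eq : (1 - 1 / (1 + l * s)) / l = s / (1 + l * s) := by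
    field_simp
    ring
  have h_div : (1 - 1 / (1 + l * s)) / l ≤ (1 - Real.exp (-l * s)) / l := by
    gcongr
  linarith

/-- The error of the implicit Euler affine reconstruction is at most `l` up to time `1`. -/
theorem affine_error_le {l s : ℝ} (hl : 0 < l) (hs₁ : s ≤ 1) :
    (1 - Real.exp (-l * s)) / l - s / (1 + l) ≤ l := by
  have h_exp : (1 - Real.exp (-l * s)) / l ≤ s := by
    rw [div_le_iff₀ hl]
    linarith [Real.add_one_le_exp (-l * s)]
  have h_frac : s - s / (1 + l) ≤ l := by
    have h_eq : s - s / (1 + l) = l * (s / (1 + l)) := by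
      field_simp
      ring
    rw [h_eq]
    exact mul_le_of_le_one_right hl.le ((div_le_one (by positivity)).2 (by linarith))
  linarith

/-- The error of the implicit Euler affine reconstruction at the final time is positive. -/
theorem affine_error_final_pos {l : ℝ} (hl : 0 < l) :
    0 < (1 - Real.exp (-l)) / l - 1 / (1 + l) := by
  have h_exp : Real.exp (-l) < 1 / (1 + l) := by
    rw [Real.exp_neg, ← one_div]
    exact one_div_lt_one_div_of_lt (by positivity) (by linarith [Real.add_one_lt_exp hl.ne'])
  have h_eq : (1 - 1 / (1 + l)) / l = 1 / (1 + l) := by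
    field_simp
    ring
  have h_div : (1 - 1 / (1 + l)) / l < (1 - Real.exp (-l)) / l := by
    gcongr
  linarith

/-- The squared energy norm of the affine reconstruction error is positive. -/
theorem affine_error_energy_pos {l : ℝ} (hl : 0 < l) :
    0 < (1/2) * ((1 - Real.exp (-l)) / l - 1 / (1 + l)) ^ 2
      + l * ∫ s in (0:ℝ)..1, ((1 - Real.exp (-l * s)) / l - s / (1 + l)) ^ 2 := by
  have h_final := affine_error_final_pos hl
  have h_int : 0 ≤ ∫ s in (0:ℝ)..1, ((1 - Real.exp (-l * s)) / l - s / (1 + l)) ^ 2 :=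
    intervalIntegral.integral_nonneg zero_le_one fun s _ => sq_nonneg _
  positivity

/-- The squared energy norm of the affine reconstruction error is of order `l ^ 2`. -/
theorem affine_error_energy_le {l : ℝ} (hl : 0 < l) (hl₁ : l ≤ 1) :
    (1/2) * ((1 - Real.exp (-l)) / l - 1 / (1 + l)) ^ 2
      + l * ∫ s in (0:ℝ)..1, ((1 - Real.exp (-l * s)) / l - s / (1 + l)) ^ 2 ≤ 2 * l ^ 2 := by
  have h_final : ((1 - Real.exp (-l)) / l - 1 / (1 + l)) ^ 2 ≤ l ^ 2 :=
    pow_le_pow_left₀ (affine_error_final_pos hl).le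
      (by simpa using affine_error_le hl le_rfl) 2
  have h_int : ∫ s in (0:ℝ)..1, ((1 - Real.exp (-l * s)) / l - s / (1 + l)) ^ 2 ≤ l ^ 2 := by
    calc ∫ s in (0:ℝ)..1, ((1 - Real.exp (-l * s)) / l - s / (1 + l)) ^ 2
        ≤ ∫ _ in (0:ℝ)..1, l ^ 2 := by
          refine intervalIntegral.integral_mono_on zero_le_one
            (Continuous.intervalIntegrable (by fun_prop) _ _)
            (Continuous.intervalIntegrable (by fun_prop) _ _) fun s hs => ?_
          exact pow_le_pow_left₀ (affine_error_nonneg hl hs.1 hs.2)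
            (affine_error_le hl hs.2) 2
      _ = l ^ 2 := by simp
  have h_cube : l * l ^ 2 ≤ l ^ 2 := mul_le_of_le_one_left (sq_nonneg l) hl₁
  have h_mul := mul_le_mul_of_nonneg_left h_int hl.le
  nlinarith [sq_nonneg l]

theorem integral_jump_sq (l : ℝ) :
    ∫ s in (0:ℝ)..1, ((1 - s) / (1 + l)) ^ 2 = 1 / 3 / (1 + l) ^ 2 := by
  simp_rw [div_pow]
  rw [intervalIntegral.integral_div,
    intervalIntegral.integral_comp_sub_left (fun x : ℝ => x ^ 2) 1, integral_pow]
  norm_num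

/-- First limit of the appendix example: the temporal jump estimator is not efficient
with respect to the energy-norm error of the continuous piecewise affine
reconstruction as `λ → 0⁺`. -/
theorem stmt_12 :
    (∀ l : ℝ, 0 < l →
      0 < Real.sqrt ((1/2) * ((1 - Real.exp (-l)) / l - 1 / (1 + l)) ^ 2
          + l * ∫ s in (0:ℝ)..1, ((1 - Real.exp (-l * s)) / l - s / (1 + l)) ^ 2))
    ∧ Tendsto
        (fun l : ℝ =>
          Real.sqrt (l * ∫ s in (0:ℝ)..1, ((1 - s) / (1 + l)) ^ 2)
            / Real.sqrt ((1/2) * ((1 - Real.exp (-l)) / l - 1 / (1 + l)) ^ 2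
                + l * ∫ s in (0:ℝ)..1, ((1 - Real.exp (-l * s)) / l - s / (1 + l)) ^ 2))
        (nhdsWithin 0 (Set.Ioi (0:ℝ))) atTop := by
  refine ⟨fun l hl => Real.sqrt_pos.2 (affine_error_energy_pos hl), ?_⟩
  have h_lim : Tendsto (fun l : ℝ => Real.sqrt (1 / 24 * l⁻¹))
      (nhdsWithin 0 (Set.Ioi (0:ℝ))) atTop :=
    Real.tendsto_sqrt_atTop.comp
      (tendsto_inv_nhdsGT_zero.const_mul_atTop (by norm_num))
  refine tendsto_atTop_mono' _ ?_ h_lim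
  filter_upwards [Ioo_mem_nhdsGT (zero_lt_one' ℝ)] with l ⟨hl, hl₁⟩
  rw [← Real.sqrt_div' _ (affine_error_energy_pos hl).le]
  refine Real.sqrt_le_sqrt ?_
  rw [le_div_iff₀ (affine_error_energy_pos hl), integral_jump_sq]
  calc _ ≤ 1 / 24 * l⁻¹ * (2 * l ^ 2) :=
        mul_le_mul_of_nonneg_left (affine_error_energy_le hl hl₁.le) (by positivity)
    _ = l * (1 / 3 / 2 ^ 2) := by
        field_simp
        norm_num
    _ ≤ l * (1 / 3 / (1 + l) ^ 2) := by
        gcongr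
        linarith
end

section
/- Finite-dimensional, exact-data version of the identity in the closing remark of Section 4 (the semidiscrete residual identity underlying the hypercircle theorem): for every continuously differentiable φ : [0,T] → ℝ^m, ⟨u(T) − u_N, φ(T)⟩ + Σ_{n=1}^{N} ∫_{t_{n-1}}^{t_n} (−⟨φ'(t), u(t) − ½(u_n + U_τ(t))⟩ + ⟨Aφ(t), u(t) − ½(u_n + U_τ(t))⟩) dt = ½ Σ_{n=1}^{N} ∫_{t_{n-1}}^{t_n} (⟨φ'(t), u_n − U_τ(t)⟩ + ⟨A(u_n − U_τ(t)), φ(t)⟩) dt. -/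
open scoped RealInnerProductSpace

/-- The residual identity on a single implicit Euler step from `v` to `w` over `[a, b]`. -/
theorem implicitEuler_step_residual_identity {E : Type*} [NormedAddCommGroup E]
    [InnerProductSpace ℝ E] [FiniteDimensional ℝ E] {A : E →ₗ[ℝ] E}
    (hsym : ∀ x y, ⟪A x, y⟫ = ⟪x, A y⟫) {a b : ℝ} (hab : a < b) {v w g : E}
    (hscheme : (b - a)⁻¹ • (w - v) + A w = g) {x φ φ' : ℝ → E}
    (hxc : ContinuousOn x (Set.Icc a b))
    (hx : ∀ s ∈ Set.Ioo a b, HasDerivAt x (g - A (x s)) s)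
    (hφc : ContinuousOn φ (Set.Icc a b))
    (hφ : ∀ s ∈ Set.Ioo a b, HasDerivAt φ (φ' s) s)
    (hφ' : ContinuousOn φ' (Set.Icc a b)) :
    ⟪x b - w, φ b⟫ - ⟪x a - v, φ a⟫
      + ∫ s in a..b,
          (-⟪φ' s, x s - (1/2 : ℝ) • (w + (((s - a) / (b - a)) • w + ((b - s) / (b - a)) • v))⟫
            + ⟪A (φ s), x s - (1/2 : ℝ) • (w
                + (((s - a) / (b - a)) • w + ((b - s) / (b - a)) • v))⟫)
      = (1/2) * ∫ s in a..b,
          (⟪φ' s, w - (((s - a) / (b - a)) • w + ((b - s) / (b - a)) • v)⟫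
            + ⟪A (w - (((s - a) / (b - a)) • w + ((b - s) / (b - a)) • v)), φ s⟫) := by
  have hba : b - a ≠ 0 := sub_ne_zero.2 hab.ne'
  have hA : Continuous A := A.continuous_of_finiteDimensional
  set U : ℝ → E := fun s => ((s - a) / (b - a)) • w + ((b - s) / (b - a)) • v with hU
  have hUc : Continuous U := by fun_prop
  have hUd (s : ℝ) : HasDerivAt U ((b - a)⁻¹ • (w - v)) s := by
    have h₁ := (((hasDerivAt_id s).sub_const a).div_const (b - a)).smul_const w
    have h₂ := (((hasDerivAt_id s).const_sub b).div_const (b - a)).smul_const v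
    refine (h₁.add h₂).congr_deriv ?_
    module
  have hUa : U a = v := by simp [hU, hba]
  have hUb : U b = w := by simp [hU, hba]
  have hAφ : ContinuousOn (fun s => A (φ s)) (Set.Icc a b) := hA.comp_continuousOn hφc
  have hUc' : ContinuousOn U (Set.Icc a b) := hUc.continuousOn
  have hderiv : ∀ s ∈ Set.Ioo a b, HasDerivAt (fun s => ⟪x s - U s, φ s⟫)
      (⟪x s - U s, φ' s⟫ + ⟪w - x s, A (φ s)⟫) s := by
    intro s hs
    refine (((hx s hs).sub (hUd s)).inner ℝ (hφ s hs)).congr_deriv ?_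
    rw [← hsym, ← hscheme, map_sub]
    congr 2
    abel
  have hD : IntervalIntegrable (fun s => ⟪x s - U s, φ' s⟫ + ⟪w - x s, A (φ s)⟫)
      MeasureTheory.volume a b :=
    ContinuousOn.intervalIntegrable_of_Icc hab.le
      (((hxc.sub hUc').inner hφ').add ((continuousOn_const.sub hxc).inner hAφ))
  have hftc := intervalIntegral.integral_eq_sub_of_hasDerivAt_of_le hab.le
    ((hxc.sub hUc').inner hφc) hderiv hD
  have hL : IntervalIntegrable (fun s => -⟪φ' s, x s - (1/2 : ℝ) • (w + U s)⟫
      + ⟪A (φ s), x s - (1/2 : ℝ) • (w + U s)⟫) MeasureTheory.volume a b := by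
    have hc : ContinuousOn (fun s => x s - (1/2 : ℝ) • (w + U s)) (Set.Icc a b) := by fun_prop
    exact ContinuousOn.intervalIntegrable_of_Icc hab.le
      ((hφ'.inner hc).neg.add (hAφ.inner hc))
  simp only [hUa, hUb] at hftc
  rw [← hftc, ← intervalIntegral.integral_add hD hL, ← intervalIntegral.integral_const_mul]
  refine intervalIntegral.integral_congr fun s _ => ?_
  change ⟪x s - U s, φ' s⟫ + ⟪w - x s, A (φ s)⟫
      + (-⟪φ' s, x s - (1/2 : ℝ) • (w + U s)⟫ + ⟪A (φ s), x s - (1/2 : ℝ) • (w + U s)⟫)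
    = (1/2) * (⟪φ' s, w - U s⟫ + ⟪A (w - U s), φ s⟫)
  rw [hsym (w - U s), real_inner_comm _ (φ' s), real_inner_comm _ (φ' s),
    real_inner_comm _ (A (φ s))]
  simp only [inner_sub_left, inner_add_left, real_inner_smul_left]
  ring

/-- Finite-dimensional, exact-data version of the semidiscrete residual identity
underlying the hypercircle theorem (closing remark of Section 4). -/
theorem stmt_14 (m : ℕ) (hm : 1 ≤ m)
    (A : EuclideanSpace ℝ (Fin m) →ₗ[ℝ] EuclideanSpace ℝ (Fin m))
    (hsym : ∀ x y, ⟪A x, y⟫ = ⟪x, A y⟫)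
    (hpos : ∀ x, x ≠ 0 → 0 < ⟪A x, x⟫)
    (T : ℝ) (hT : 0 < T)
    (N : ℕ) (hN : 1 ≤ N)
    (t : ℕ → ℝ) (ht0 : t 0 = 0) (htN : t N = T)
    (hmono : ∀ n < N, t n < t (n + 1))
    (u : ℕ → EuclideanSpace ℝ (Fin m)) (f : ℕ → EuclideanSpace ℝ (Fin m))
    (hscheme : ∀ n < N,
      (t (n + 1) - t n)⁻¹ • (u (n + 1) - u n) + A (u (n + 1)) = f (n + 1))
    (uex : ℝ → EuclideanSpace ℝ (Fin m))
    (huc : ContinuousOn uex (Set.Icc (0:ℝ) T))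
    (hu0 : uex 0 = u 0)
    (hode : ∀ n < N, ∀ s ∈ Set.Ioo (t n) (t (n + 1)),
      HasDerivAt uex (f (n + 1) - A (uex s)) s)
    (φ φ' : ℝ → EuclideanSpace ℝ (Fin m))
    (hφ : ∀ s ∈ Set.Icc (0:ℝ) T, HasDerivWithinAt φ (φ' s) (Set.Icc (0:ℝ) T) s)
    (hφ' : ContinuousOn φ' (Set.Icc (0:ℝ) T)) :
    ⟪uex T - u N, φ T⟫
      + ∑ n ∈ Finset.range N, ∫ s in (t n)..(t (n + 1)),
          (-⟪φ' s, uex s - (1/2 : ℝ) • (u (n + 1)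
              + (((s - t n) / (t (n + 1) - t n)) • u (n + 1)
                + ((t (n + 1) - s) / (t (n + 1) - t n)) • u n))⟫
            + ⟪A (φ s), uex s - (1/2 : ℝ) • (u (n + 1)
                + (((s - t n) / (t (n + 1) - t n)) • u (n + 1)
                  + ((t (n + 1) - s) / (t (n + 1) - t n)) • u n))⟫)
      = (1/2) * ∑ n ∈ Finset.range N, ∫ s in (t n)..(t (n + 1)),
          (⟪φ' s, u (n + 1) - (((s - t n) / (t (n + 1) - t n)) • u (n + 1)
              + ((t (n + 1) - s) / (t (n + 1) - t n)) • u n)⟫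
            + ⟪A (u (n + 1) - (((s - t n) / (t (n + 1) - t n)) • u (n + 1)
                + ((t (n + 1) - s) / (t (n + 1) - t n)) • u n)), φ s⟫) := by
  have hmon : ∀ i j, i ≤ j → j ≤ N → t i ≤ t j := by
    intro i j hij
    induction j, hij using Nat.le_induction with
    | base => exact fun _ => le_rfl
    | succ j _ ih => exact fun hj => (ih (by omega)).trans (hmono j (by omega)).le
  have hφc : ContinuousOn φ (Set.Icc 0 T) := fun s hs => (hφ s hs).continuousWithinAt
  have htele := Finset.sum_range_sub (fun n => ⟪uex (t n) - u n, φ (t n)⟫) N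
  simp only [ht0, htN, hu0, sub_self, inner_zero_left, sub_zero] at htele
  rw [← htele, ← Finset.sum_add_distrib, Finset.mul_sum]
  refine Finset.sum_congr rfl fun n hn => ?_
  rw [Finset.mem_range] at hn
  have h₀ : 0 ≤ t n := ht0 ▸ hmon 0 n n.zero_le hn.le
  have h₁ : t (n + 1) ≤ T := htN ▸ hmon (n + 1) N hn le_rfl
  have hsub : Set.Icc (t n) (t (n + 1)) ⊆ Set.Icc 0 T := Set.Icc_subset_Icc h₀ h₁
  refine implicitEuler_step_residual_identity hsym (hmono n hn) (hscheme n hn) (huc.mono hsub)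
    (hode n hn) (hφc.mono hsub) (fun s hs => ?_) (hφ'.mono hsub)
  exact (hφ s (hsub (Set.Ioo_subset_Icc_self hs))).hasDerivAt
    (Icc_mem_nhds (h₀.trans_lt hs.1) (hs.2.trans_le h₁))
end
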